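/- arXiv:0704.2600 — 3 statements merged into one kernel-verified Lean document; each statement's English description precedes it below -/
import Mathlib

section
/- If x ∈ B_n is a left rigid (respectively right rigid) pseudo-Anosov braid with ℓ(x) > 1, then x is conjugate to a right rigid (respectively left rigid) braid. -/
/-!
Axiomatization of Garside groups (positive cone, Garside element, lattice
structure, left/right normal forms), following the paper
"On the cycling operation in braid groups" by Gebhardt and González-Meneses.
-/

namespace Garside

variable {G : Type*} [Group G]

/-- `a ≼ b`: `a` is a left divisor (prefix) of `b` w.r.t. the positive cone `P`. -/
def LeftDvd (P : Submonoid G) (a b : G) : Prop := a⁻¹ * b ∈ P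

/-- `a` is a right divisor (suffix) of `b` w.r.t. the positive cone `P`
(i.e. `b ≽ a` in the notation of the paper). -/
def RightDvd (P : Submonoid G) (a b : G) : Prop := b * a⁻¹ ∈ P

/-- A simple element: a positive prefix of `Δ`. -/
def Simple (P : Submonoid G) (Δ : G) (s : G) : Prop := s ∈ P ∧ LeftDvd P s Δ

/-- An atom: a nontrivial positive element which is not the product
of two nontrivial positive elements. -/
def Atom (P : Submonoid G) (a : G) : Prop :=
  a ∈ P ∧ a ≠ 1 ∧ ∀ b c : G, b ∈ P → c ∈ P → a = b * c → b = 1 ∨ c = 1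

/-- `Δ^p x₁ ⋯ x_r` (with `l = [x₁,…,x_r]`) is the left normal form of `x`:
each factor is a proper simple element and consecutive factors are
left-weighted, `x_i = (x_i x_{i+1}) ∧_L Δ`. -/
def IsLeftNF (P : Submonoid G) (Δ : G) (gcdL : G → G → G) (p : ℤ) (l : List G) (x : G) :
    Prop :=
  x = Δ ^ p * l.prod ∧ (∀ s ∈ l, Simple P Δ s ∧ s ≠ 1 ∧ s ≠ Δ) ∧
    l.Chain' (fun s t => gcdL (s * t) Δ = s)

/-- `y₁ ⋯ y_r Δ^p` (with `l = [y₁,…,y_r]`) is the right normal form of `x`: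
each factor is a proper simple element and consecutive factors are
right-weighted, `y_{i+1} = (y_i y_{i+1}) ∧_R Δ`. -/
def IsRightNF (P : Submonoid G) (Δ : G) (gcdR : G → G → G) (p : ℤ) (l : List G) (x : G) :
    Prop :=
  x = l.prod * Δ ^ p ∧ (∀ s ∈ l, Simple P Δ s ∧ s ≠ 1 ∧ s ≠ Δ) ∧
    l.Chain' (fun s t => gcdR (s * t) Δ = t)

/-- A Garside structure on a group `G`: a positive cone which induces lattice
orders by left and right divisibility, and a Garside element `Δ` whose left and
right divisors coincide (the simple elements), generate the group, and such that
every element admits a unique left and right normal form. -/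
structure GarsideGroup (G : Type*) [Group G] where
  pos : Submonoid G
  pos_antisymm : ∀ a : G, a ∈ pos → a⁻¹ ∈ pos → a = 1
  Δ : G
  Δ_pos : Δ ∈ pos
  gcdL : G → G → G
  gcdL_dvd_left : ∀ a b : G, LeftDvd pos (gcdL a b) a
  gcdL_dvd_right : ∀ a b : G, LeftDvd pos (gcdL a b) b
  dvd_gcdL : ∀ a b c : G, LeftDvd pos c a → LeftDvd pos c b → LeftDvd pos c (gcdL a b)
  lcmL : G → G → G
  dvd_lcmL_left : ∀ a b : G, LeftDvd pos a (lcmL a b)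
  dvd_lcmL_right : ∀ a b : G, LeftDvd pos b (lcmL a b)
  lcmL_dvd : ∀ a b c : G, LeftDvd pos a c → LeftDvd pos b c → LeftDvd pos (lcmL a b) c
  gcdR : G → G → G
  gcdR_dvd_left : ∀ a b : G, RightDvd pos (gcdR a b) a
  gcdR_dvd_right : ∀ a b : G, RightDvd pos (gcdR a b) b
  dvd_gcdR : ∀ a b c : G, RightDvd pos c a → RightDvd pos c b → RightDvd pos c (gcdR a b)
  lcmR : G → G → G
  dvd_lcmR_left : ∀ a b : G, RightDvd pos a (lcmR a b)
  dvd_lcmR_right : ∀ a b : G, RightDvd pos b (lcmR a b)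
  lcmR_dvd : ∀ a b c : G, RightDvd pos a c → RightDvd pos b c → RightDvd pos (lcmR a b) c
  divisors_Δ : ∀ s : G, (s ∈ pos ∧ LeftDvd pos s Δ) ↔ (s ∈ pos ∧ RightDvd pos s Δ)
  simples_generate : Subgroup.closure {s : G | Simple pos Δ s} = ⊤
  lnf_exists : ∀ x : G, ∃ pl : ℤ × List G, IsLeftNF pos Δ gcdL pl.1 pl.2 x
  lnf_unique : ∀ (x : G) (p q : ℤ) (l m : List G),
    IsLeftNF pos Δ gcdL p l x → IsLeftNF pos Δ gcdL q m x → p = q ∧ l = m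
  rnf_exists : ∀ x : G, ∃ pl : ℤ × List G, IsRightNF pos Δ gcdR pl.1 pl.2 x
  rnf_unique : ∀ (x : G) (p q : ℤ) (l m : List G),
    IsRightNF pos Δ gcdR p l x → IsRightNF pos Δ gcdR q m x → p = q ∧ l = m
  lnf_rnf_agree : ∀ (x : G) (p q : ℤ) (l m : List G),
    IsLeftNF pos Δ gcdL p l x → IsRightNF pos Δ gcdR q m x → p = q ∧ l.length = m.length

/-- `L` is the left lcm of the set `S`. -/
def IsLcmL (P : Submonoid G) (S : Set G) (L : G) : Prop :=
  (∀ a ∈ S, LeftDvd P a L) ∧ ∀ c : G, (∀ a ∈ S, LeftDvd P a c) → LeftDvd P L c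

/-- A Garside group is atom-friendly (on the left) if `Δ` is the left lcm of the
set of atoms and the starting set of the left lcm of any set `B` of atoms is `B`. -/
def AtomFriendlyL (𝒢 : GarsideGroup G) : Prop :=
  IsLcmL 𝒢.pos {a : G | Atom 𝒢.pos a} 𝒢.Δ ∧
    ∀ B : Set G, B ⊆ {a : G | Atom 𝒢.pos a} →
      ∃ L : G, IsLcmL 𝒢.pos B L ∧ {a : G | Atom 𝒢.pos a ∧ LeftDvd 𝒢.pos a L} = B

namespace GarsideGroup

variable (𝒢 : GarsideGroup G)

/-- The left normal form of `x`, as a pair (infimum, list of factors). -/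
noncomputable def lnf (x : G) : ℤ × List G := Classical.choose (𝒢.lnf_exists x)

/-- The right normal form of `x`, as a pair (exponent of `Δ`, list of factors). -/
noncomputable def rnf (x : G) : ℤ × List G := Classical.choose (𝒢.rnf_exists x)

/-- `inf x = p`, the maximal `p` with `Δ^p ≼ x`. -/
noncomputable def inf (x : G) : ℤ := (𝒢.lnf x).1

/-- The canonical length `ℓ(x) = r`. -/
noncomputable def len (x : G) : ℕ := (𝒢.lnf x).2.length

/-- `sup x = p + r`. -/
noncomputable def sup (x : G) : ℤ := 𝒢.inf x + 𝒢.len x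

/-- `tau 𝒢 k x = τ^k(x) = Δ^{-k} x Δ^k`. -/
def tau (k : ℤ) (x : G) : G := 𝒢.Δ ^ (-k) * x * 𝒢.Δ ^ k

/-- The left initial factor `ι_L(x) = τ^{-p}(x₁)` (equal to `1` if `ℓ(x) = 0`). -/
noncomputable def iotaL (x : G) : G := 𝒢.tau (-(𝒢.lnf x).1) ((𝒢.lnf x).2.headD 1)

/-- The right initial factor `ι_R(x) = τ^{p}(y_r)` (equal to `1` if `ℓ(x) = 0`). -/
noncomputable def iotaR (x : G) : G := 𝒢.tau (𝒢.rnf x).1 (((𝒢.rnf x).2.getLast?).getD 1)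

/-- Left cycling: `c_L(x) = ι_L(x)⁻¹ · x · ι_L(x)`. -/
noncomputable def cL (x : G) : G := (𝒢.iotaL x)⁻¹ * x * 𝒢.iotaL x

/-- Right cycling: `c_R(x) = ι_R(x) · x · ι_R(x)⁻¹`. -/
noncomputable def cR (x : G) : G := 𝒢.iotaR x * x * (𝒢.iotaR x)⁻¹

/-- `x = Δ^p x₁⋯x_r` (in left normal form, `r > 0`) is left rigid if
`Δ^p x₁⋯x_r ι_L(x)` is in left normal form as written. -/
def LeftRigid (x : G) : Prop :=
  (𝒢.lnf x).2 ≠ [] ∧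
    IsLeftNF 𝒢.pos 𝒢.Δ 𝒢.gcdL (𝒢.lnf x).1 ((𝒢.lnf x).2 ++ [𝒢.iotaL x]) (x * 𝒢.iotaL x)

/-- `x = y₁⋯y_r Δ^p` (in right normal form, `r > 0`) is right rigid if
`ι_R(x) y₁⋯y_r Δ^p` is in right normal form as written. -/
def RightRigid (x : G) : Prop :=
  (𝒢.rnf x).2 ≠ [] ∧
    IsRightNF 𝒢.pos 𝒢.Δ 𝒢.gcdR (𝒢.rnf x).1 (𝒢.iotaR x :: (𝒢.rnf x).2) (𝒢.iotaR x * x)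

/-- The super summit set: conjugates of minimal canonical length. -/
def SSS (x : G) : Set G :=
  {y | IsConj x y ∧ ∀ z : G, IsConj x z → 𝒢.len y ≤ 𝒢.len z}

/-- The left ultra summit set. -/
def USSL (x : G) : Set G :=
  {y ∈ 𝒢.SSS x | ∃ t : ℕ, 1 ≤ t ∧ (𝒢.cL)^[t] y = y}

/-- The right ultra summit set. -/
def USSR (x : G) : Set G :=
  {y ∈ 𝒢.SSS x | ∃ t : ℕ, 1 ≤ t ∧ (𝒢.cR)^[t] y = y}

/-- `x` is periodically geodesic: `inf(x^m) = m inf(x)` and `sup(x^m) = m sup(x)`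
for all `m ≥ 1`. -/
def PeriodicallyGeodesic (x : G) : Prop :=
  ∀ m : ℕ, 1 ≤ m → 𝒢.inf (x ^ m) = (m : ℤ) * 𝒢.inf x ∧ 𝒢.sup (x ^ m) = (m : ℤ) * 𝒢.sup x

/-- The left interior `x°_L = x Δ^{-p}`, where `p = inf(x)`. -/
noncomputable def intL (x : G) : G := x * 𝒢.Δ ^ (-𝒢.inf x)

/-- The right interior `x°_R = Δ^{-p} x`, where `p = inf(x)`. -/
noncomputable def intR (x : G) : G := 𝒢.Δ ^ (-𝒢.inf x) * x

/-- The right transport of `v` (where `v x v⁻¹ = z`):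
`v^{(1)}_R = ι_R(z) · v · ι_R(x)⁻¹`. -/
noncomputable def transR (x v : G) : G := 𝒢.iotaR (v * x * v⁻¹) * v * (𝒢.iotaR x)⁻¹

/-- The iterated right transport `v^{(i)}_R` of `v` along the right cyclings of `x`. -/
noncomputable def transRIter (x : G) : ℕ → G → G
  | 0, v => v
  | i + 1, v => 𝒢.transR ((𝒢.cR)^[i] x) (transRIter x i v)

/-- Arrows of the left ultra summit graph `USG_L(x)`: triples `(u, s, v)` with
`u, v ∈ USS_L(x)`, `s` simple and `s⁻¹ u s = v`. -/
def ArrL (x : G) : Set (G × G × G) :=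
  {a | a.1 ∈ 𝒢.USSL x ∧ a.2.2 ∈ 𝒢.USSL x ∧ Simple 𝒢.pos 𝒢.Δ a.2.1 ∧
    a.2.1⁻¹ * a.1 * a.2.1 = a.2.2}

/-- Arrows of the right ultra summit graph `USG_R(x)`: triples `(u, s, v)` with
`u, v ∈ USS_R(x)`, `s` simple and `s u s⁻¹ = v`. -/
def ArrR (x : G) : Set (G × G × G) :=
  {a | a.1 ∈ 𝒢.USSR x ∧ a.2.2 ∈ 𝒢.USSR x ∧ Simple 𝒢.pos 𝒢.Δ a.2.1 ∧
    a.2.1 * a.1 * a.2.1⁻¹ = a.2.2}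

/-- `PathFrom A u l`: the list of arrows `l` forms a directed path in the
graph with arrow set `A`, starting at the vertex `u`. -/
def PathFrom (A : Set (G × G × G)) : G → List (G × G × G) → Prop
  | _, [] => True
  | u, a :: rest => a ∈ A ∧ a.1 = u ∧ PathFrom A a.2.2 rest

/-- Minimal arrows of `USG_L(x)`: arrows whose label is not a product of the
labels of a directed path of length at least 2 starting at the same vertex. -/
def MinArrL (x : G) : Set (G × G × G) :=
  {a | a ∈ 𝒢.ArrL x ∧ ¬ ∃ l : List (G × G × G), 2 ≤ l.length ∧
    PathFrom (𝒢.ArrL x) a.1 l ∧ (l.map (fun b => b.2.1)).prod = a.2.1}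

/-- Minimal arrows of `USG_R(x)`. -/
def MinArrR (x : G) : Set (G × G × G) :=
  {a | a ∈ 𝒢.ArrR x ∧ ¬ ∃ l : List (G × G × G), 2 ≤ l.length ∧
    PathFrom (𝒢.ArrR x) a.1 l ∧ (l.map (fun b => b.2.1)).prod = a.2.1}

end GarsideGroup

end Garside

namespace Garside

/-- The braid relations on `m` generators `σ₀, …, σ_{m-1}`:
`σᵢσⱼ = σⱼσᵢ` for `|i-j| > 1` and `σᵢσⱼσᵢ = σⱼσᵢσⱼ` for `|i-j| = 1`. -/
def braidRels (m : ℕ) : Set (FreeGroup (Fin m)) :=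
  {r | (∃ i j : Fin m, (i : ℕ) + 1 < (j : ℕ) ∧
          r = FreeGroup.of i * FreeGroup.of j * (FreeGroup.of i)⁻¹ * (FreeGroup.of j)⁻¹) ∨
       (∃ i j : Fin m, (i : ℕ) + 1 = (j : ℕ) ∧
          r = FreeGroup.of i * FreeGroup.of j * FreeGroup.of i *
              (FreeGroup.of j * FreeGroup.of i * FreeGroup.of j)⁻¹)}

/-- Artin's braid group on `n` strands, presented by the `n-1` generators
`σ₁, …, σ_{n-1}` and the braid relations. -/
abbrev BraidGroup (n : ℕ) := PresentedGroup (braidRels (n - 1))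

/-- The Artin generators of the braid group. -/
def σB (n : ℕ) (i : Fin (n - 1)) : BraidGroup n :=
  PresentedGroup.of (rels := braidRels (n - 1)) i

/-- The half twist `Δ = σ₁ (σ₂σ₁) ⋯ (σ_{n-1} ⋯ σ₁)`, the Garside element of `Bₙ`. -/
def halfTwist (n : ℕ) : BraidGroup n :=
  ((List.finRange (n - 1)).map fun k =>
    ((((List.finRange (n - 1)).filter fun j => decide (j ≤ k)).reverse.map (σB n)).prod)).prod

/-- `𝒢` is the (left and right) Garside structure of the braid group `Bₙ`:
the positive cone is the monoid of positive braids, generated by the Artin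
generators, and the Garside element is the half twist `Δ`. -/
def IsBraidGarside (n : ℕ) (𝒢 : GarsideGroup (BraidGroup n)) : Prop :=
  𝒢.pos = Submonoid.closure (Set.range (σB n)) ∧ 𝒢.Δ = halfTwist n

end Garside

namespace Garside

/-- The `i`-th puncture, as an element of `Fin n`, for `i : Fin (n-1)`. -/
def punct (n : ℕ) (i : Fin (n - 1)) : Fin n :=
  ⟨(i : ℕ), by have := i.isLt; omega⟩

/-- The `(i+1)`-st puncture, as an element of `Fin n`, for `i : Fin (n-1)`. -/
def punct' (n : ℕ) (i : Fin (n - 1)) : Fin n :=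
  ⟨(i : ℕ) + 1, by have := i.isLt; omega⟩

/-- `ρ` is the Artin representation of `Bₙ` in the automorphism group of the
free group on the `n` punctures: `σᵢ` sends `xᵢ ↦ xᵢ x_{i+1} xᵢ⁻¹`,
`x_{i+1} ↦ xᵢ` and fixes all other generators. -/
def IsArtinRep (n : ℕ) (ρ : BraidGroup n →* MulAut (FreeGroup (Fin n))) : Prop :=
  ∀ i : Fin (n - 1),
    (ρ (σB n i)) (FreeGroup.of (punct n i)) =
        FreeGroup.of (punct n i) * FreeGroup.of (punct' n i) *
          (FreeGroup.of (punct n i))⁻¹ ∧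
    (ρ (σB n i)) (FreeGroup.of (punct' n i)) = FreeGroup.of (punct n i) ∧
    ∀ k : Fin n, k ≠ punct n i → k ≠ punct' n i →
      (ρ (σB n i)) (FreeGroup.of k) = FreeGroup.of k

/-- The element `x_i x_{i+1} ⋯ x_j` of the free group on the punctures,
representing the standard round curve enclosing the punctures `i, …, j`. -/
def stdCurveElt (n : ℕ) (i j : Fin n) : FreeGroup (Fin n) :=
  (((List.finRange n).filter fun k => decide (i ≤ k ∧ k ≤ j)).map FreeGroup.of).prod

/-- Isotopy classes of essential simple closed curves in the `n`-punctured disc,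
encoded as conjugacy classes in the free group on the punctures: the images under
the braid group action of the standard round curves enclosing between `2` and
`n - 1` consecutive punctures. -/
def CurveClasses (n : ℕ) (ρ : BraidGroup n →* MulAut (FreeGroup (Fin n))) :
    Set (Set (FreeGroup (Fin n))) :=
  {C | ∃ (g : BraidGroup n) (i j : Fin n), (i : ℕ) < (j : ℕ) ∧ (j : ℕ) - (i : ℕ) + 2 ≤ n ∧
    C = {w | IsConj ((ρ g) (stdCurveElt n i j)) w}}

/-- `x ∈ Bₙ` is reducible: regarded as a homeomorphism of the `n`-punctured
disc, it preserves a family of disjoint, closed, essential curves up to isotopy;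
equivalently, some positive power of `x` fixes the isotopy class of an essential
simple closed curve. -/
def BraidReducible (n : ℕ) (ρ : BraidGroup n →* MulAut (FreeGroup (Fin n)))
    (x : BraidGroup n) : Prop :=
  ∃ k : ℕ, 1 ≤ k ∧ ∃ C ∈ CurveClasses n ρ, (⇑(ρ (x ^ k))) '' C = C

/-- `x ∈ Bₙ` is periodic: `x^m = Δ^t` for some nonzero integers `m, t`. -/
def BraidPeriodic (n : ℕ) (x : BraidGroup n) : Prop :=
  ∃ m t : ℤ, m ≠ 0 ∧ t ≠ 0 ∧ x ^ m = (halfTwist n) ^ t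

/-- `x ∈ Bₙ` is pseudo-Anosov: in the Nielsen–Thurston classification it is
neither periodic nor reducible. -/
def PseudoAnosov (n : ℕ) (ρ : BraidGroup n →* MulAut (FreeGroup (Fin n)))
    (x : BraidGroup n) : Prop :=
  ¬ BraidPeriodic n x ∧ ¬ BraidReducible n ρ x

end Garside

namespace GProof

variable {G : Type*} [Group G]

/-- The abstract data used in the proof. -/
structure Core (P : Submonoid G) (Δ : G) (lam : G → ℤ) : Prop where
  Δ_mem : Δ ∈ P
  conj1 : ∀ a ∈ P, Δ * a * Δ⁻¹ ∈ P
  conj2 : ∀ a ∈ P, Δ⁻¹ * a * Δ ∈ P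
  lam_mul : ∀ a b, lam (a * b) = lam a + lam b
  lam_nonneg : ∀ a ∈ P, 0 ≤ lam a
  lam_zero : ∀ a ∈ P, lam a = 0 → a = 1
  fin : ∀ k : ℤ, {a | a ∈ P ∧ lam a = k}.Finite
  central : ∃ e : ℕ, 0 < e ∧ ∀ g : G, Δ ^ e * g = g * Δ ^ e
  gcdL : ∀ a b : G, ∃ g, g⁻¹ * a ∈ P ∧ g⁻¹ * b ∈ P ∧
    ∀ c, c⁻¹ * a ∈ P → c⁻¹ * b ∈ P → c⁻¹ * g ∈ P
  gcdR : ∀ a b : G, ∃ g, a * g⁻¹ ∈ P ∧ b * g⁻¹ ∈ P ∧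
    ∀ c, a * c⁻¹ ∈ P → b * c⁻¹ ∈ P → g * c⁻¹ ∈ P

/-- `Δ^p ≼ x ≼ Δ^(p+r)`. -/
def Good (P : Submonoid G) (Δ : G) (p r : ℤ) (x : G) : Prop :=
  x * Δ ^ (-p) ∈ P ∧ x⁻¹ * Δ ^ (p + r) ∈ P

/-- gcd formulation of left rigidity. -/
def LC (P : Submonoid G) (Δ : G) (p r : ℤ) (x : G) : Prop :=
  ∀ d, d⁻¹ * (x * x) ∈ P → d⁻¹ * Δ ^ (2 * p + r) ∈ P → d⁻¹ * (x * Δ ^ p) ∈ P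

/-- gcd formulation of right rigidity. -/
def RC (P : Submonoid G) (Δ : G) (p r : ℤ) (x : G) : Prop :=
  ∀ d, (x * x) * d⁻¹ ∈ P → Δ ^ (2 * p + r) * d⁻¹ ∈ P → (Δ ^ p * x) * d⁻¹ ∈ P

namespace Core

variable {P : Submonoid G} {Δ : G} {lam : G → ℤ}

theorem conjz (C : Core P Δ lam) (i : ℤ) (a : G) (ha : a ∈ P) : Δ ^ i * a * Δ ^ (-i) ∈ P := by
  induction i using Int.induction_on with
  | zero => simpa using ha
  | succ i ih =>
    have := C.conj1 _ ih
    convert this using 1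
    group
  | pred i ih =>
    have := C.conj2 _ ih
    convert this using 1
    group

theorem conjz' (C : Core P Δ lam) {a b : G} (i : ℤ) (ha : a ∈ P) (h : b = Δ ^ i * a * Δ ^ (-i)) : b ∈ P :=
  h ▸ C.conjz i a ha

theorem lam_one (C : Core P Δ lam) : lam 1 = 0 := by
  have := C.lam_mul 1 1
  simp at this
  exact this

theorem lam_inv (C : Core P Δ lam) (a : G) : lam a⁻¹ = - lam a := by
  have := C.lam_mul a⁻¹ a
  simp [C.lam_one] at this
  omega

theorem lam_pow (C : Core P Δ lam) (a : G) (k : ℕ) : lam (a ^ k) = k * lam a := by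
  induction k with
  | zero => simp [C.lam_one]
  | succ k ih => rw [pow_succ, C.lam_mul, ih]; push_cast; ring

theorem lam_zpow (C : Core P Δ lam) (a : G) (k : ℤ) : lam (a ^ k) = k * lam a := by
  induction k using Int.induction_on with
  | zero => simp [C.lam_one]
  | succ k ih => rw [zpow_add_one, C.lam_mul, ih]; ring
  | pred k ih => rw [zpow_sub_one, C.lam_mul, ih, C.lam_inv]; ring

theorem Δpow_mem (C : Core P Δ lam) (k : ℕ) : Δ ^ (k : ℤ) ∈ P := by
  rw [zpow_natCast]; exact P.pow_mem C.Δ_mem k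

theorem pow_good (C : Core P Δ lam) {p r : ℤ} {x : G} (hg : Good P Δ p r x) (m : ℕ) :
    x ^ m * Δ ^ (-(p * m)) ∈ P := by
  induction m with
  | zero => simp
  | succ m ih =>
    have h2 := P.mul_mem ih (C.conjz (p * m) _ hg.1)
    convert h2 using 1
    rw [pow_succ]; push_cast; group

theorem A1 (C : Core P Δ lam) {p r : ℤ} {x : G} (hg : Good P Δ p r x) (hL : LC P Δ p r x) (m : ℕ) :
    ∀ d, d⁻¹ * x ^ (m + 1) ∈ P → d⁻¹ * Δ ^ (p * (m + 1 : ℕ) + r) ∈ P →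
      d⁻¹ * (x * Δ ^ (p * m)) ∈ P := by
  induction m with
  | zero => intro d h1 _; simpa using h1
  | succ m ih =>
    intro d h1 h2
    have h3 := ih (x⁻¹ * d) (by
        convert h1 using 1
        rw [pow_succ' x (m + 1)]; group) (by
        have := P.mul_mem h2 (C.conjz (-(p * (m + 1 : ℕ) + r) + -p) _ hg.1)
        convert this using 1
        push_cast; group)
    have h4 := hL (d * Δ ^ (-(p * m))) (by
        convert C.conjz (p * m) _ h3 using 1
        group) (by
        convert C.conjz (p * m) _ h2 using 1
        push_cast; group)
    convert C.conjz (-(p * m)) _ h4 using 1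
    push_cast; group

theorem B1 (C : Core P Δ lam) {p r : ℤ} {x : G} (hg : Good P Δ p r x) (hL : LC P Δ p r x) (hr : 0 ≤ r) (M : ℕ) :
    ∀ (i : ℕ) d, d⁻¹ * x ^ (M + i) ∈ P → d⁻¹ * Δ ^ (p * (M + i : ℕ) + r * M) ∈ P →
      d⁻¹ * (x ^ M * Δ ^ (p * i)) ∈ P := by
  induction M with
  | zero => intro i d _ h2; simpa using h2
  | succ M ih =>
    intro i d h1 h2
    obtain ⟨g, hg1, hg2, hg3⟩ := C.gcdL d (Δ ^ (p * (M + i + 1 : ℕ) + r))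
    have e1 : M + 1 + i = M + i + 1 := by omega
    rw [e1] at h1 h2
    have h3 := C.A1 hg hL (M + i) g (by
      have := P.mul_mem hg1 h1
      convert this using 1; group) hg2
    have hrM : Δ ^ (r * M) ∈ P := by
      have := C.Δpow_mem (r.toNat * M)
      push_cast at this
      rwa [Int.toNat_of_nonneg hr] at this
    have h4 := hg3 (d * Δ ^ (-(r * M))) (by
      convert hrM using 1; group) (by
      convert C.conjz (r * M) _ h2 using 1
      push_cast; group)
    have h5 := P.mul_mem h4 h3
    have h6 := ih i (x⁻¹ * d) (by
      convert h1 using 1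
      rw [pow_succ' x (M + i)]; group) (by
      convert C.conjz (-(r * M)) _ h5 using 1
      push_cast; group)
    convert h6 using 1
    rw [pow_succ']; group

theorem main (C : Core P Δ lam) {p r : ℤ} (hr : 0 ≤ r) {x : G} (hg : Good P Δ p r x) (hL : LC P Δ p r x) :
    ∃ z, IsConj x z ∧ Good P Δ p r z ∧ RC P Δ p r z := by
  by_contra hcon
  push Not at hcon
  obtain ⟨e, he, hcen⟩ := C.central
  have hcz : ∀ (i : ℤ) (g : G), Δ ^ (i * (2 * e)) * g = g * Δ ^ (i * (2 * e)) := by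
    intro i g
    have h1 : Commute (Δ ^ e) g := hcen g
    have h2 := h1.zpow_left (2 * i)
    have h3 : (Δ ^ e) ^ (2 * i) = Δ ^ (i * (2 * e)) := by
      rw [← zpow_natCast, ← zpow_mul]; congr 1; ring
    rw [h3] at h2
    exact h2
  obtain ⟨E, hE⟩ : ∃ E : ℕ, 2 * e = E + 2 := ⟨2 * e - 2, by omega⟩
  have hEz : (2 * e : ℤ) = E + 2 := by exact_mod_cast hE
  rw [hEz] at hcz
  set Q : G := Δ ^ (-p * (E + 2)) with hQ
  have hQc : ∀ g, Q * g = g * Q := hcz (-p)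
  set X : G := x ^ (E + 2) * Q with hX
  have hxX : Commute x X := by
    have : Commute x Q := (hQc x).symm
    exact ((Commute.refl x).pow_right _).mul_right this
  choose T hT1 hT2 hT3 using fun k : ℕ => C.gcdR (X ^ k) (Δ ^ (r * k))
  have hXP : X ∈ P := by
    have := C.pow_good hg (E + 2)
    convert this using 2
    rw [hQ]; congr 1; push_cast; ring
  have hrk : ∀ k : ℕ, Δ ^ (r * k) ∈ P := by
    intro k
    have := C.Δpow_mem (r.toNat * k)
    push_cast at this
    rwa [Int.toNat_of_nonneg hr] at this
  have hTP : ∀ k, T k ∈ P := by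
    intro k
    have := hT3 k 1 (by simpa using P.pow_mem hXP k) (by simpa using hrk k)
    simpa using this
  have F1 : ∀ (k : ℕ) (y : G) (q : ℤ), Commute y X → y * Δ ^ q ∈ P →
      T k * y * (T k)⁻¹ * Δ ^ q ∈ P := by
    intro k y q hy hyq
    have := hT3 k (Δ ^ (-q) * T k * Δ ^ q * (y * Δ ^ q)⁻¹) (by
      have h1 := P.mul_mem hyq (C.conjz (-q) _ (hT1 k))
      convert h1 using 1
      have h2 : X ^ k * y = y * X ^ k := (hy.pow_right k).symm
      have : X ^ k * (Δ ^ (-q) * T k * Δ ^ q * (y * Δ ^ q)⁻¹)⁻¹ =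
        (X ^ k * y) * (T k)⁻¹ * Δ ^ q := by group
      rw [this, h2]; group) (by
      have h1 := P.mul_mem (C.conjz (r * k) _ hyq) (C.conjz (-q) _ (hT2 k))
      convert h1 using 1
      group)
    convert this using 1
    group
  have F2 : ∀ k, Good P Δ p r (T k * x * (T k)⁻¹) := by
    intro k
    refine ⟨F1 k x _ hxX hg.1, ?_⟩
    have := F1 k x⁻¹ _ hxX.inv_left hg.2
    convert this using 1
    group
  set c : ℤ := lam x - p * lam Δ with hc
  have F3 : ∀ k, lam (T k) + c + 1 ≤ lam (T (k + 1)) := by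
    intro k
    have hz := F2 k
    have hnR := hcon _ (isConj_iff.2 ⟨T k, rfl⟩) hz
    set z := T k * x * (T k)⁻¹ with hzdef
    have hlz : lam z = lam x := by
      rw [hzdef, C.lam_mul, C.lam_mul, C.lam_inv]; ring
    unfold RC at hnR
    push Not at hnR
    obtain ⟨d, hd1, hd2, hd3⟩ := hnR
    obtain ⟨g, hg1, hg2, hg3⟩ := C.gcdR (z * z) (Δ ^ (2 * p + r))
    have hu := hg3 (Δ ^ p * z) (by
      convert hz.1 using 1; group) (by
      convert C.conjz (2 * p + r) _ hz.2 using 1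
      group)
    have hu1 : g * (Δ ^ p * z)⁻¹ ≠ 1 := by
      intro h
      have h' : g = Δ ^ p * z := by
        rwa [mul_inv_eq_one] at h
      exact hd3 (h' ▸ hg3 d hd1 hd2)
    have hu2 : 1 ≤ lam (g * (Δ ^ p * z)⁻¹) := by
      have h0 := C.lam_nonneg _ hu
      have h1 : lam (g * (Δ ^ p * z)⁻¹) ≠ 0 := fun h => hu1 (C.lam_zero _ hu h)
      omega
    have hw := hT3 (k + 1) (Δ ^ (-2 * p) * g * T k) (by
      have h1 := P.mul_mem (C.pow_good hg E) (C.conjz (-2 * p) _ (P.mul_mem (hT1 k) hg1))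
      convert h1 using 1
      have hc2 : X ^ k * (x * x) = x * x * X ^ k :=
        (((hxX.pow_right k).mul_left (hxX.pow_right k))).symm
      have e1 : X ^ (k + 1) = x ^ E * Q * (X ^ k * (x * x)) := by
        have e0 : X = x ^ E * Q * (x * x) := by
          rw [hX, pow_add, pow_two, mul_assoc (x ^ E) Q, hQc (x * x), mul_assoc]
        rw [hc2, pow_succ' X k]
        nth_rewrite 1 [e0]
        simp only [mul_assoc]
      have e2 : Q = Δ ^ (-(p * E)) * Δ ^ (-2 * p) := by
        rw [hQ, ← zpow_add]; congr 1; ring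
      rw [e1, e2, hzdef]
      group) (by
      have h1 := P.mul_mem (C.conjz r _ (hT2 k)) (C.conjz (-2 * p) _ hg2)
      convert h1 using 1
      push_cast
      group)
    have hw2 := C.lam_nonneg _ hw
    simp only [C.lam_mul, C.lam_inv, C.lam_zpow] at hw2 hu2
    rw [hlz] at hu2
    linarith
  have hc0 : 0 ≤ c := by
    have := C.lam_nonneg _ hg.1
    rw [C.lam_mul, C.lam_zpow] at this
    linarith
  have F3' : ∀ (k i : ℕ), lam (T k) + i * (c + 1) ≤ lam (T (k + i)) := by
    intro k i
    induction i with
    | zero => simp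
    | succ i ih =>
      have := F3 (k + i)
      rw [← add_assoc]; push_cast; linarith
  -- pigeonhole
  have hfin : Finite {a // a ∈ P ∧ lam a = c} := (C.fin c).to_subtype
  let f : ℕ → {a // a ∈ P ∧ lam a = c} := fun k =>
    ⟨T k * x * (T k)⁻¹ * Δ ^ (-p), (F2 k).1, by
      simp only [C.lam_mul, C.lam_inv, C.lam_zpow, hc]; ring⟩
  obtain ⟨y, hy⟩ := Finite.exists_infinite_fiber f
  have hy' : (f ⁻¹' {y}).Infinite := Set.infinite_coe_iff.1 hy
  obtain ⟨k, hk⟩ := hy'.nonempty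
  obtain ⟨j, hj, hjk⟩ := hy'.exists_gt (k * (c + 1).toNat + k)
  obtain ⟨i, rfl⟩ : ∃ i, j = k + i := ⟨j - k, by omega⟩
  have hzz : T k * x * (T k)⁻¹ = T (k + i) * x * (T (k + i))⁻¹ := by
    have h1 : f k = f (k + i) := by
      rw [Set.mem_preimage, Set.mem_singleton_iff] at hk hj
      rw [hk, hj]
    have h2 := congrArg Subtype.val h1
    exact mul_right_cancel h2
  set j := k + i with hjdef
  have hV : Commute x ((T k)⁻¹ * T j) := by
    have : (T k)⁻¹ * (T k * x * (T k)⁻¹) * T j = (T k)⁻¹ * (T j * x * (T j)⁻¹) * T j := by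
      rw [hzz]
    have h2 : x * ((T k)⁻¹ * T j) = ((T k)⁻¹ * T j) * x := by
      convert this using 1 <;> group
    exact h2
  have hVX : Commute ((T k)⁻¹ * T j) X :=
    ((hV.symm.pow_right _).mul_right (hQc _).symm)
  have hV1 : ((T k)⁻¹ * T j)⁻¹ * X ^ j ∈ P := by
    have h1 : ((T k)⁻¹ * T j)⁻¹ * X ^ j = X ^ j * ((T k)⁻¹ * T j)⁻¹ :=
      (hVX.inv_left.pow_right j)
    rw [h1]
    convert P.mul_mem (hT1 j) (hTP k) using 1
    group
  have hV2 : ((T k)⁻¹ * T j)⁻¹ * Δ ^ (r * j) ∈ P := by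
    have h1 := P.mul_mem (C.conjz (-(r * j)) _ (hT2 j)) (C.conjz (-(r * j)) _ (hTP k))
    convert h1 using 1
    group
  have hXj : X ^ j = x ^ ((E + 2) * j) * Δ ^ (-(p * ((E + 2) * j))) := by
    have hcm : Commute (x ^ (E + 2)) Q := (hQc _).symm
    rw [hX, hcm.mul_pow, ← pow_mul, hQ, ← zpow_natCast (Δ ^ _), ← zpow_mul]
    congr 2; ring
  have hM : (E + 2) * j = j + (E + 1) * j := by ring
  have hB := C.B1 hg hL hr j ((E + 1) * j) ((T k)⁻¹ * T j * Δ ^ (p * ((E + 2) * j))) (by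
    rw [hXj] at hV1
    rw [← hM]
    convert C.conjz (-(p * ((E + 2) * j))) _ hV1 using 1
    group) (by
    convert C.conjz (-(p * ((E + 2) * j))) _ hV2 using 1
    push_cast
    group)
  have hB2 := C.lam_nonneg _ hB
  simp only [C.lam_mul, C.lam_inv, C.lam_zpow, C.lam_pow] at hB2
  have hlow := F3' k i
  have hup : lam (T j) - lam (T k) ≤ j * c := by
    rw [hc]
    push_cast at hB2
    linarith
  have hjz : (k : ℤ) * (c + 1) + k < j := by
    have : ((k * (c + 1).toNat + k : ℕ) : ℤ) < (j : ℕ) := by exact_mod_cast hjk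
    push_cast at this
    rw [Int.toNat_of_nonneg (by linarith)] at this
    exact this
  have hji : (j : ℤ) = k + i := by rw [hjdef]; push_cast; ring
  rw [← hjdef] at hlow
  have hk0 : (0 : ℤ) ≤ k := Int.natCast_nonneg k
  nlinarith

end Core
end GProof
namespace GProof

open Garside

variable {G : Type*} [Group G]

/-- Weak form of left-weightedness. -/
def WL (P : Submonoid G) (Δ : G) (s t : G) : Prop :=
  ∀ d, d⁻¹ * (s * t) ∈ P → d⁻¹ * Δ ∈ P → d⁻¹ * s ∈ P

theorem head_lemma {P : Submonoid G} {Δ : G}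
    (hconj : ∀ s, Simple P Δ s → Δ⁻¹ * s * Δ ∈ P) (l : List G) :
    ∀ s, (∀ t ∈ s :: l, Simple P Δ t) → (s :: l).IsChain (WL P Δ) →
      ∀ d, d⁻¹ * (s :: l).prod ∈ P → d⁻¹ * Δ ∈ P → d⁻¹ * s ∈ P := by
  induction l with
  | nil => intro s _ _ d h1 _; simpa using h1
  | cons t l ih =>
    intro s hs hch d h1 h2
    rw [List.isChain_cons_cons] at hch
    refine hch.1 d ?_ h2
    have := ih t (fun u hu => hs u (List.mem_cons_of_mem _ hu)) hch.2 (s⁻¹ * d) (by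
      convert h1 using 1
      rw [List.prod_cons (a := s)]; group) (by
      convert P.mul_mem h2 (hconj s (hs s (by simp))) using 1
      group)
    convert this using 1
    group

namespace Core

variable {P : Submonoid G} {Δ : G} {lam : G → ℤ}

theorem antisymm (C : Core P Δ lam) {a b : G} (h1 : a⁻¹ * b ∈ P) (h2 : b⁻¹ * a ∈ P) : a = b := by
  have e1 := C.lam_nonneg _ h1
  have e2 := C.lam_nonneg _ h2
  have : a⁻¹ * b = 1 := by
    apply C.lam_zero _ h1
    simp only [C.lam_mul, C.lam_inv] at *
    omega
  exact inv_mul_eq_one.1 this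

theorem prod_lemma (C : Core P Δ lam) (l1 : List G) : ∀ l2 : List G, (∀ t ∈ l1 ++ l2, Simple P Δ t) →
    (l1 ++ l2).IsChain (WL P Δ) →
      ∀ d, d⁻¹ * (l1 ++ l2).prod ∈ P → d⁻¹ * Δ ^ (l1.length : ℤ) ∈ P → d⁻¹ * l1.prod ∈ P := by
  induction l1 with
  | nil => intro l2 _ _ d _ h2; simpa using h2
  | cons s l1 ih =>
    intro l2 hs hch d h1 h2
    obtain ⟨g, hg1, hg2, hg3⟩ := C.gcdL d Δ
    have h3 := head_lemma (P := P) (Δ := Δ) (fun s hs => C.conj2 s hs.1) (l1 ++ l2) s hs hch g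
      (by convert P.mul_mem hg1 h1 using 1; simp) hg2
    have h4 := hg3 (d * Δ ^ (-(l1.length : ℤ))) (by
      convert C.Δpow_mem l1.length using 1; group) (by
      convert C.conjz (l1.length : ℤ) _ h2 using 1
      push_cast [List.length_cons]; group)
    have h5 := P.mul_mem h4 h3
    have h6 := ih l2 (fun u hu => hs u (List.mem_cons_of_mem _ hu)) hch.tail (s⁻¹ * d) (by
      convert h1 using 1
      rw [List.cons_append, List.prod_cons]; group) (by
      convert C.conjz (-(l1.length : ℤ)) _ h5 using 1
      group)
    convert h6 using 1
    rw [List.prod_cons]; group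

theorem prod_mem (C : Core P Δ lam) (l : List G) (hs : ∀ t ∈ l, Simple P Δ t) : l.prod ∈ P :=
  P.list_prod_mem fun t ht => (hs t ht).1

theorem prod_le (C : Core P Δ lam) (l : List G) (hs : ∀ t ∈ l, Simple P Δ t) :
    (l.prod)⁻¹ * Δ ^ (l.length : ℤ) ∈ P := by
  induction l with
  | nil => simp
  | cons s l ih =>
    have h1 := ih fun u hu => hs u (List.mem_cons_of_mem _ hu)
    have h2 := C.conjz (-(l.length : ℤ)) _ (hs s (by simp)).2
    convert P.mul_mem h1 h2 using 1
    rw [List.prod_cons]; push_cast [List.length_cons]; group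

theorem lam_pos (C : Core P Δ lam) {s : G} (hs : s ∈ P) (h1 : s ≠ 1) : 0 < lam s := by
  have h0 := C.lam_nonneg s hs
  have : lam s ≠ 0 := fun h => h1 (C.lam_zero s hs h)
  omega

theorem lam_lt (C : Core P Δ lam) {s : G} (hs : Simple P Δ s) (h1 : s ≠ Δ) : lam s < lam Δ := by
  have := C.lam_pos hs.2 (fun h => h1 (inv_mul_eq_one.1 h))
  rw [C.lam_mul, C.lam_inv] at this
  omega

theorem lam_prod_nonneg (C : Core P Δ lam) (l : List G) (hs : ∀ t ∈ l, Simple P Δ t) : 0 ≤ lam l.prod :=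
  C.lam_nonneg _ (C.prod_mem l hs)

theorem lam_prod_le (C : Core P Δ lam) (l : List G) (hs : ∀ t ∈ l, Simple P Δ t) :
    lam l.prod ≤ l.length * lam Δ := by
  have := C.lam_nonneg _ (C.prod_le l hs)
  rw [C.lam_mul, C.lam_inv, C.lam_zpow] at this
  linarith

theorem WL_conj (C : Core P Δ lam) (i : ℤ) {s t : G} (h : WL P Δ s t) :
    WL P Δ (Δ ^ i * s * Δ ^ (-i)) (Δ ^ i * t * Δ ^ (-i)) := by
  intro d h1 h2
  have := h (Δ ^ (-i) * d * Δ ^ i) (by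
    convert C.conjz (-i) _ h1 using 1; group) (by
    convert C.conjz (-i) _ h2 using 1; group)
  convert C.conjz i _ this using 1
  group

theorem prod_map_conj (C : Core P Δ lam) (i : ℤ) (l : List G) :
    (l.map fun a => Δ ^ i * a * Δ ^ (-i)).prod = Δ ^ i * l.prod * Δ ^ (-i) := by
  induction l with
  | nil => simp
  | cons a l ih => rw [List.map_cons, List.prod_cons, ih, List.prod_cons]; group

theorem simple_conj (C : Core P Δ lam) (i : ℤ) {s : G} (hs : Simple P Δ s) :
    Simple P Δ (Δ ^ i * s * Δ ^ (-i)) := by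
  refine ⟨C.conjz i _ hs.1, ?_⟩
  have := C.conjz i _ hs.2
  unfold LeftDvd
  convert this using 1
  group

theorem WL_of {g : G → G → G}
    (hg3 : ∀ a b c, c⁻¹ * a ∈ P → c⁻¹ * b ∈ P → c⁻¹ * g a b ∈ P)
    {s t : G} (h : g (s * t) Δ = s) : WL P Δ s t := by
  intro d h1 h2
  have := hg3 _ _ d h1 h2
  rwa [h] at this

theorem WL_to (C : Core P Δ lam) {g : G → G → G}
    (hg1 : ∀ a b, (g a b)⁻¹ * a ∈ P)
    (hg2 : ∀ a b, (g a b)⁻¹ * b ∈ P)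
    (hg3 : ∀ a b c, c⁻¹ * a ∈ P → c⁻¹ * b ∈ P → c⁻¹ * g a b ∈ P)
    {s t : G} (hs : Simple P Δ s) (ht : t ∈ P) (h : WL P Δ s t) :
    g (s * t) Δ = s := by
  refine C.antisymm (h _ (hg1 _ _) (hg2 _ _)) (hg3 _ _ _ ?_ hs.2)
  simpa using ht

theorem bridgeA (C : Core P Δ lam) {g : G → G → G}
    (hg3 : ∀ a b c, c⁻¹ * a ∈ P → c⁻¹ * b ∈ P → c⁻¹ * g a b ∈ P)
    {p : ℤ} {l : List G} {x : G} (hx : IsLeftNF P Δ g p l x) (hl : l ≠ [])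
    (hrig : (l ++ [Δ ^ p * l.headD 1 * Δ ^ (-p)]).IsChain (fun s t => g (s * t) Δ = s)) :
    Good P Δ p l.length x ∧ LC P Δ p l.length x ∧
      p * lam Δ < lam x ∧ lam x < (p + l.length) * lam Δ := by
  obtain ⟨hx1, hx2, hx3⟩ := hx
  have hsim : ∀ t ∈ l, Simple P Δ t := fun t ht => (hx2 t ht).1
  refine ⟨⟨?_, ?_⟩, ?_, ?_⟩
  · rw [hx1]; exact C.conjz p _ (C.prod_mem l hsim)
  · convert C.prod_le l hsim using 1
    rw [hx1]; group
  · intro d h1 h2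
    set l' := l.map fun a => Δ ^ p * a * Δ ^ (-p) with hl'
    have hch : (l ++ l').IsChain (WL P Δ) := by
      have h3 : (l ++ [Δ ^ p * l.headD 1 * Δ ^ (-p)]).IsChain (WL P Δ) :=
        hrig.imp fun s t h => WL_of hg3 h
      rw [List.isChain_append] at h3 ⊢
      refine ⟨h3.1, ?_, ?_⟩
      · rw [hl', List.isChain_map]
        exact h3.1.imp fun s t h => C.WL_conj p h
      · intro a ha b hb
        apply h3.2.2 a ha b
        obtain ⟨c, l0, rfl⟩ := List.exists_cons_of_ne_nil hl
        simpa [hl'] using hb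
    have hs2 : ∀ t ∈ l ++ l', Simple P Δ t := by
      intro t ht
      rcases List.mem_append.1 ht with h | h
      · exact hsim t h
      · obtain ⟨a, ha, rfl⟩ := List.mem_map.1 h
        exact C.simple_conj p (hsim a ha)
    have h5 := C.prod_lemma l l' hs2 hch (Δ ^ (-p) * d * Δ ^ (-p)) (by
      convert C.conjz p _ h1 using 1
      rw [List.prod_append, hl', C.prod_map_conj, hx1]; group) (by
      convert C.conjz p _ h2 using 1
      group)
    convert C.conjz (-p) _ h5 using 1
    rw [hx1]; group
  · obtain ⟨c, l0, rfl⟩ := List.exists_cons_of_ne_nil hl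
    have a1 := C.lam_pos (hsim c (by simp)).1 (hx2 c (by simp)).2.1
    have a2 := C.lam_lt (hsim c (by simp)) (hx2 c (by simp)).2.2
    have a3 := C.lam_prod_nonneg l0 fun t ht => hsim t (List.mem_cons_of_mem _ ht)
    have a4 := C.lam_prod_le l0 fun t ht => hsim t (List.mem_cons_of_mem _ ht)
    rw [hx1, C.lam_mul, C.lam_zpow, List.prod_cons, C.lam_mul]
    push_cast [List.length_cons]
    constructor
    · linarith
    · linarith

theorem bridgeB (C : Core P Δ lam) {g : G → G → G}
    (hg1 : ∀ a b, (g a b)⁻¹ * a ∈ P)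
    (hg2 : ∀ a b, (g a b)⁻¹ * b ∈ P)
    (hg3 : ∀ a b c, c⁻¹ * a ∈ P → c⁻¹ * b ∈ P → c⁻¹ * g a b ∈ P)
    {p : ℤ} {r : ℕ} (hr : 0 < r) {q : ℤ} {m : List G} {z : G}
    (hsimple : ∀ a ∈ P, a ≠ 1 → ∃ s ∈ P, s ≠ 1 ∧ s⁻¹ * Δ ∈ P ∧ s⁻¹ * a ∈ P)
    (hz : IsLeftNF P Δ g q m z) (hgood : Good P Δ p r z) (hLC : LC P Δ p r z)
    (hl1 : p * lam Δ < lam z) (hl2 : lam z < (p + r) * lam Δ) :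
    m ≠ [] ∧ IsLeftNF P Δ g q (m ++ [Δ ^ q * m.headD 1 * Δ ^ (-q)])
      (z * (Δ ^ q * m.headD 1 * Δ ^ (-q))) := by
  have hzNF := hz
  obtain ⟨hz1, hz2, hz3⟩ := hz
  have hsim : ∀ t ∈ m, Simple P Δ t := fun t ht => (hz2 t ht).1
  have hWL : m.IsChain (WL P Δ) := hz3.imp fun s t h => WL_of hg3 h
  have hδ : 0 < lam Δ := by
    have : (r : ℤ) * lam Δ > 0 := by linarith
    have h0 : (0 : ℤ) < r := by exact_mod_cast hr
    exact pos_of_mul_pos_right this h0.le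
  have hzlam : lam z = q * lam Δ + lam m.prod := by rw [hz1, C.lam_mul, C.lam_zpow]
  -- coprimality
  have cop : ∀ s ∈ P, s⁻¹ * (Δ ^ (-p) * z) ∈ P → s⁻¹ * (Δ ^ (-p) * z⁻¹ * Δ ^ (2 * p + r)) ∈ P →
      s = 1 := by
    intro s hs h1 h2
    have := hLC (z * Δ ^ p * s) (by
      convert h1 using 1; group) (by
      convert h2 using 1; group)
    have h3 : s⁻¹ ∈ P := by
      convert this using 1; group
    exact C.antisymm (by simpa using h3) (by simpa using hs)
  have ha : Δ ^ (-p) * z ∈ P := by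
    convert C.conjz (-p) _ hgood.1 using 1; group
  have hb : Δ ^ (-p) * z⁻¹ * Δ ^ (2 * p + r) ∈ P := by
    convert C.conjz (-p) _ hgood.2 using 1; group
  have ha1 : Δ ^ (-p) * z ≠ 1 := by
    intro h
    have := congrArg lam h
    rw [C.lam_mul, C.lam_zpow, C.lam_one] at this
    linarith
  have hb1 : Δ ^ (-p) * z⁻¹ * Δ ^ (2 * p + r) ≠ 1 := by
    intro h
    have := congrArg lam h
    simp only [C.lam_mul, C.lam_zpow, C.lam_one, C.lam_inv] at this
    linarith
  have hpq : p ≤ q := by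
    by_contra hlt
    push Not at hlt
    obtain ⟨k, hk⟩ : ∃ k : ℕ, p = q + 1 + k := ⟨(p - q - 1).toNat, by omega⟩
    have h1 : Δ⁻¹ * m.prod ∈ P := by
      convert P.mul_mem (C.Δpow_mem k) ha using 1
      rw [hz1, hk]; group
    cases m with
    | nil =>
      have := C.lam_nonneg _ h1
      simp [C.lam_inv] at this
      omega
    | cons s l =>
      have h2 := head_lemma (P := P) (Δ := Δ) (fun s hs => C.conj2 s hs.1) l s hsim hWL Δ h1
        (by simp)
      exact (hz2 s (by simp)).2.2 (C.antisymm (hsim s (by simp)).2 h2)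
  have hlen : q + m.length ≤ p + r := by
    have hq : q < p + r := by
      have := C.lam_prod_nonneg m hsim
      nlinarith
    by_contra hlt
    push Not at hlt
    obtain ⟨k, hk⟩ : ∃ k : ℕ, p + r = q + k := ⟨(p + r - q).toNat, by omega⟩
    have hkm : k < m.length := by omega
    have h1 : (m.prod)⁻¹ * Δ ^ (k : ℤ) ∈ P := by
      convert hgood.2 using 1
      rw [hz1, hk]; group
    have hlk : (m.take k).length = k := by simp; omega
    have h2 := C.prod_lemma (m.take k) (m.drop k) (by simpa using hsim) (by simpa using hWL)
      m.prod (by simp) (by rw [hlk]; exact h1)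
    have h3 := C.lam_nonneg _ h2
    rw [C.lam_mul, C.lam_inv] at h3
    have h4 : lam m.prod = lam (m.take k).prod + lam (m.drop k).prod := by
      rw [← C.lam_mul, ← List.prod_append, List.take_append_drop]
    obtain ⟨c, l0, hc⟩ : ∃ c l0, m.drop k = c :: l0 := by
      apply List.exists_cons_of_ne_nil
      intro h
      have := congrArg List.length h
      simp at this
      omega
    have hmem : ∀ t ∈ c :: l0, t ∈ m := fun t ht => List.mem_of_mem_drop (hc ▸ ht)
    have a1 := C.lam_pos (hsim c (hmem c (by simp))).1 (hz2 c (hmem c (by simp))).2.1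
    have a3 := C.lam_prod_nonneg l0 fun t ht => hsim t (hmem t (List.mem_cons_of_mem _ ht))
    rw [hc, List.prod_cons, C.lam_mul] at h4
    omega
  have hqp : q = p := by
    by_contra hne
    obtain ⟨k, hk⟩ : ∃ k : ℕ, q = p + 1 + k := ⟨(q - p - 1).toNat, by omega⟩
    obtain ⟨s, hs, hs1, hsΔ, hsb⟩ := hsimple _ hb hb1
    refine hs1 (cop s hs ?_ hsb)
    convert P.mul_mem (P.mul_mem hsΔ (C.Δpow_mem k)) (C.prod_mem m hsim) using 1
    rw [hz1, hk]; group
  subst hqp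
  have hlen' : m.length = r := by
    by_contra hne
    obtain ⟨k, hk⟩ : ∃ k : ℕ, r = m.length + 1 + k := ⟨r - m.length - 1, by omega⟩
    obtain ⟨s, hs, hs1, hsΔ, hsa⟩ := hsimple _ ha ha1
    refine hs1 (cop s hs hsa ?_)
    have h1 := C.conjz (-1 - q) _ (P.mul_mem (C.prod_le m hsim) (C.Δpow_mem k))
    convert P.mul_mem hsΔ h1 using 1
    rw [hz1, hk]; push_cast; group
  have hm : m ≠ [] := by
    intro h
    rw [h] at hlen'
    simp at hlen'
    omega
  refine ⟨hm, ?_, ?_, ?_⟩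
  · rw [List.prod_append, hz1]; simp [mul_assoc]
  · intro s hs
    rcases List.mem_append.1 hs with h | h
    · exact hz2 s h
    · obtain ⟨c, l0, rfl⟩ := List.exists_cons_of_ne_nil hm
      simp only [List.headD_cons, List.mem_singleton] at h
      have hc := hz2 c (by simp)
      rw [h]
      refine ⟨C.simple_conj q hc.1, ?_, ?_⟩
      · intro h1
        apply hc.2.1
        have : c = Δ ^ (-q) * (Δ ^ q * c * Δ ^ (-q)) * Δ ^ q := by group
        rw [this, h1]; group
      · intro h1
        apply hc.2.2
        have : c = Δ ^ (-q) * (Δ ^ q * c * Δ ^ (-q)) * Δ ^ q := by group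
        rw [this, h1]; group
  · have goal2 : (m ++ [Δ ^ q * m.headD 1 * Δ ^ (-q)]).IsChain (fun s t => g (s * t) Δ = s) := by
      rw [List.isChain_append]
      refine ⟨hz3, by simp, ?_⟩
      intro y hy b hb'
      simp only [List.head?_cons, Option.mem_def, Option.some.injEq] at hb'
      subst hb'
      have hym : y ∈ m := List.mem_of_mem_getLast? hy
      obtain ⟨m0, rfl⟩ : ∃ m0, m = m0 ++ [y] := ⟨_, (List.dropLast_append_getLast? y hy).symm⟩
      obtain ⟨h, tl, htl⟩ := List.exists_cons_of_ne_nil hm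
      have hh : h ∈ m0 ++ [y] := by rw [htl]; simp
      rw [htl, List.headD_cons]
      refine C.WL_to hg1 hg2 hg3 (hsim y hym) (C.conjz q _ (hsim h hh).1) ?_
      intro e h1 h2
      have hm0 : ∀ t ∈ m0, Simple P Δ t := fun t ht => hsim t (by simp [ht])
      have htlP : tl.prod ∈ P := C.prod_mem tl fun t ht => hsim t (by rw [htl]; simp [ht])
      have hz1' : z = Δ ^ q * (h * tl.prod) := by rw [hz1, htl, List.prod_cons]
      have hz1'' : z = Δ ^ q * (m0.prod * y) := by rw [hz1]; simp
      have h3 := hLC (Δ ^ q * m0.prod * e * Δ ^ q) (by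
        convert P.mul_mem (C.conjz (-q) _ h1) htlP using 1
        nth_rewrite 1 [hz1'']
        rw [hz1']; group) (by
        have h4 := C.conjz (-1) _ (C.prod_le m0 hm0)
        convert C.conjz (-q) _ (P.mul_mem h2 h4) using 1
        rw [← hlen', List.length_append, List.length_singleton]
        push_cast; group)
      convert C.conjz q _ h3 using 1
      rw [hz1'']; group
    exact goal2

end Core
end GProof
namespace GProof

open Garside MulOpposite

section raw

variable {G : Type*} [Group G]

theorem inf_nonneg {P : Submonoid G} {Δ : G} {g : G → G → G}
    (hconj : ∀ s, Simple P Δ s → Δ⁻¹ * s * Δ ∈ P) (hΔ : Δ ∈ P) (hΔ1 : Δ ≠ 1)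
    (hanti : ∀ a : G, a ∈ P → a⁻¹ ∈ P → a = 1)
    (hg3 : ∀ a b c, c⁻¹ * a ∈ P → c⁻¹ * b ∈ P → c⁻¹ * g a b ∈ P)
    {p : ℤ} {l : List G} {a : G} (h : IsLeftNF P Δ g p l a) (ha : a ∈ P) : 0 ≤ p := by
  obtain ⟨h1, h2, h3⟩ := h
  by_contra hlt
  push Not at hlt
  obtain ⟨k, hk⟩ : ∃ k : ℕ, p = - 1 - k := ⟨(-1 - p).toNat, by omega⟩
  have h4 : Δ⁻¹ * l.prod ∈ P := by
    convert P.mul_mem (P.pow_mem hΔ k) ha using 1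
    rw [h1, hk]; group
  cases l with
  | nil => exact hΔ1 (hanti Δ hΔ (by simpa using h4))
  | cons s l =>
    have h5 := head_lemma hconj l s (fun t ht => (h2 t ht).1)
      (List.IsChain.imp (fun s t h => Core.WL_of hg3 h) h3) Δ h4 (by simp)
    have h6 := hanti _ h5 (by
      have := (h2 s (by simp)).1.2
      unfold Garside.LeftDvd at this
      convert this using 1; group)
    exact (h2 s (by simp)).2.2 (inv_mul_eq_one.1 h6).symm

theorem simple_div {P : Submonoid G} {Δ : G} {g : G → G → G}
    (hconj : ∀ s, Simple P Δ s → Δ⁻¹ * s * Δ ∈ P) (hΔ : Δ ∈ P) (hΔ1 : Δ ≠ 1)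
    (hanti : ∀ a : G, a ∈ P → a⁻¹ ∈ P → a = 1)
    (hg3 : ∀ a b c, c⁻¹ * a ∈ P → c⁻¹ * b ∈ P → c⁻¹ * g a b ∈ P)
    (hex : ∀ x : G, ∃ p l, IsLeftNF P Δ g p l x) :
    ∀ a ∈ P, a ≠ 1 → ∃ s ∈ P, s ≠ 1 ∧ s⁻¹ * Δ ∈ P ∧ s⁻¹ * a ∈ P := by
  intro a ha ha1
  obtain ⟨p, l, h⟩ := hex a
  have hp := inf_nonneg hconj hΔ hΔ1 hanti hg3 h ha
  obtain ⟨h1, h2, h3⟩ := h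
  have hlP : ∀ l' : List G, (∀ t ∈ l', t ∈ l) → l'.prod ∈ P := fun l' h' =>
    P.list_prod_mem fun t ht => (h2 t (h' t ht)).1.1
  rcases hp.eq_or_lt with hp | hp
  · cases l with
    | nil => exact absurd (by rw [h1, ← hp]; simp) ha1
    | cons s l =>
      refine ⟨s, (h2 s (by simp)).1.1, (h2 s (by simp)).2.1, (h2 s (by simp)).1.2, ?_⟩
      rw [h1, ← hp]
      simpa using hlP l (fun t ht => List.mem_cons_of_mem _ ht)
  · obtain ⟨k, hk⟩ : ∃ k : ℕ, p = 1 + k := ⟨(p - 1).toNat, by omega⟩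
    refine ⟨Δ, hΔ, hΔ1, by simp, ?_⟩
    convert P.mul_mem (P.pow_mem hΔ k) (hlP l fun t ht => ht) using 1
    rw [h1, hk]; group

variable {P : Submonoid G} {Δ : G} {lam : G → ℤ}

theorem op_pow (i : ℤ) : (op Δ) ^ i = op (Δ ^ i) := (op_zpow Δ i).symm

theorem Core.opp (C : Core P Δ lam) : Core P.op (op Δ) (fun a => lam (unop a)) where
  Δ_mem := C.Δ_mem
  conj1 := fun a ha => by
    have := C.conj2 _ (Submonoid.mem_op.1 ha)
    rw [Submonoid.mem_op]
    simpa [mul_assoc] using this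
  conj2 := fun a ha => by
    have := C.conj1 _ (Submonoid.mem_op.1 ha)
    rw [Submonoid.mem_op]
    simpa [mul_assoc] using this
  lam_mul := fun a b => by rw [unop_mul, C.lam_mul]; ring
  lam_nonneg := fun a ha => C.lam_nonneg _ ha
  lam_zero := fun a ha h => by
    have := C.lam_zero _ (Submonoid.mem_op.1 ha) h
    exact unop_injective (by simpa using this)
  fin := fun k => by
    refine ((C.fin k).image op).subset ?_
    intro a ha
    exact ⟨unop a, ⟨ha.1, ha.2⟩, rfl⟩
  central := by
    obtain ⟨e, he, h⟩ := C.central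
    refine ⟨e, he, fun g => ?_⟩
    apply unop_injective
    simpa using (h (unop g)).symm
  gcdL := fun a b => by
    obtain ⟨g, h1, h2, h3⟩ := C.gcdR (unop a) (unop b)
    exact ⟨op g, h1, h2, fun c hc1 hc2 => h3 (unop c) hc1 hc2⟩
  gcdR := fun a b => by
    obtain ⟨g, h1, h2, h3⟩ := C.gcdL (unop a) (unop b)
    exact ⟨op g, h1, h2, fun c hc1 hc2 => h3 (unop c) hc1 hc2⟩

theorem Good_op (C : Core P Δ lam) {p r : ℤ} {x : G} :
    Good P.op (op Δ) p r (op x) ↔ Good P Δ p r x := by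
  unfold Good
  rw [op_pow, op_pow, ← op_mul, ← op_inv, ← op_mul, Submonoid.mem_op, Submonoid.mem_op,
    unop_op, unop_op]
  constructor
  · rintro ⟨h1, h2⟩
    constructor
    · convert C.conjz p _ h1 using 1; group
    · convert C.conjz (-(p + r)) _ h2 using 1; group
  · rintro ⟨h1, h2⟩
    constructor
    · convert C.conjz (-p) _ h1 using 1; group
    · convert C.conjz (p + r) _ h2 using 1; group

theorem LC_op {p r : ℤ} {x : G} : LC P.op (op Δ) p r (op x) ↔ RC P Δ p r x := by
  unfold LC RC
  constructor
  · intro h d h1 h2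
    have := h (op d)
    rw [op_pow, op_pow] at this
    exact this h1 h2
  · intro h d h1 h2
    rw [op_pow] at h2 ⊢
    exact h (unop d) h1 h2

theorem RC_op {p r : ℤ} {x : G} : RC P.op (op Δ) p r (op x) ↔ LC P Δ p r x := by
  unfold LC RC
  constructor
  · intro h d h1 h2
    have := h (op d)
    rw [op_pow, op_pow] at this
    exact this h1 h2
  · intro h d h1 h2
    rw [op_pow] at h2 ⊢
    exact h (unop d) h1 h2

theorem Simple_op (C : Core P Δ lam) {s : G} :
    Simple P.op (op Δ) (op s) ↔ Simple P Δ s := by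
  unfold Simple LeftDvd
  rw [← op_inv, ← op_mul, Submonoid.mem_op, Submonoid.mem_op, unop_op, unop_op]
  refine and_congr_right fun _ => ⟨fun h => ?_, fun h => ?_⟩
  · convert C.conj2 _ h using 1; group
  · convert C.conj1 _ h using 1; group

/-- the gcd function of the opposite group -/
def gop (gR : G → G → G) (a b : Gᵐᵒᵖ) : Gᵐᵒᵖ := op (gR (unop a) (unop b))

theorem chain_op {gR : G → G → G} {l : List G} :
    ((l.map op).reverse).IsChain (fun s t => gop gR (s * t) (op Δ) = s) ↔
      l.IsChain (fun s t => gR (s * t) Δ = t) := by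
  rw [List.isChain_reverse, List.isChain_map]
  simp [gop]

theorem NF_op (C : Core P Δ lam) {gR : G → G → G} {p : ℤ} {l : List G} {x : G} :
    IsLeftNF P.op (op Δ) (gop gR) p (l.map op).reverse (op x) ↔ IsRightNF P Δ gR p l x := by
  unfold IsLeftNF IsRightNF
  rw [← op_list_prod, op_pow, ← op_mul, op_inj]
  refine and_congr_right fun _ => and_congr ?_ chain_op
  constructor
  · intro h s hs
    have := h (op s) (by simpa using hs)
    rw [Simple_op C] at this
    refine ⟨this.1, fun h => this.2.1 (by rw [h]; rfl), fun h => this.2.2 (by rw [h])⟩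
  · intro h s hs
    obtain ⟨t, ht, rfl⟩ : ∃ t ∈ l, op t = s := by simpa using hs
    have := h t ht
    rw [Simple_op C]
    exact ⟨this.1, fun h => this.2.1 (op_injective h), fun h => this.2.2 (op_injective h)⟩

end raw

section garside

variable {G : Type*} [Group G]

theorem leftToRight (𝒢 : GarsideGroup G) {lam : G → ℤ} (C : Core 𝒢.pos 𝒢.Δ lam) (hΔ1 : 𝒢.Δ ≠ 1)
    (x : G) (hx : 𝒢.LeftRigid x) : ∃ y, IsConj x y ∧ 𝒢.RightRigid y := by
  obtain ⟨hne, hrig⟩ := hx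
  have hxNF : IsLeftNF 𝒢.pos 𝒢.Δ 𝒢.gcdL (𝒢.lnf x).1 (𝒢.lnf x).2 x :=
    Classical.choose_spec (𝒢.lnf_exists x)
  have hio : 𝒢.iotaL x = 𝒢.Δ ^ (𝒢.lnf x).1 * (𝒢.lnf x).2.headD 1 * 𝒢.Δ ^ (-(𝒢.lnf x).1) := by
    unfold GarsideGroup.iotaL GarsideGroup.tau
    rw [neg_neg]
  rw [hio] at hrig
  obtain ⟨a1, a2, a3, a4⟩ := C.bridgeA 𝒢.dvd_gcdL hxNF hne hrig.2.2
  obtain ⟨z, hz1, hz2, hz3⟩ := C.main (Int.natCast_nonneg _) a1 a2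
  have hlz : lam z = lam x := by
    obtain ⟨c, rfl⟩ := isConj_iff.1 hz1
    rw [C.lam_mul, C.lam_mul, C.lam_inv]; ring
  refine ⟨z, hz1, ?_⟩
  have hzNF : IsRightNF 𝒢.pos 𝒢.Δ 𝒢.gcdR (𝒢.rnf z).1 (𝒢.rnf z).2 z :=
    Classical.choose_spec (𝒢.rnf_exists z)
  have hΔop : op 𝒢.Δ ≠ 1 := fun h => hΔ1 (op_injective h)
  have hanti : ∀ a : Gᵐᵒᵖ, a ∈ 𝒢.pos.op → a⁻¹ ∈ 𝒢.pos.op → a = 1 := fun a h1 h2 =>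
    unop_injective (𝒢.pos_antisymm (unop a) h1 h2)
  have hg1 : ∀ a b, (gop 𝒢.gcdR a b)⁻¹ * a ∈ 𝒢.pos.op := fun a b =>
    𝒢.gcdR_dvd_left (unop a) (unop b)
  have hg2 : ∀ a b, (gop 𝒢.gcdR a b)⁻¹ * b ∈ 𝒢.pos.op := fun a b =>
    𝒢.gcdR_dvd_right (unop a) (unop b)
  have hg3 : ∀ a b c, c⁻¹ * a ∈ 𝒢.pos.op → c⁻¹ * b ∈ 𝒢.pos.op →
      c⁻¹ * gop 𝒢.gcdR a b ∈ 𝒢.pos.op := fun a b c =>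
    𝒢.dvd_gcdR (unop a) (unop b) (unop c)
  have hex : ∀ w : Gᵐᵒᵖ, ∃ p l, IsLeftNF 𝒢.pos.op (op 𝒢.Δ) (gop 𝒢.gcdR) p l w := by
    intro w
    obtain ⟨pl, h⟩ := 𝒢.rnf_exists (unop w)
    exact ⟨_, _, (NF_op C).2 h⟩
  have hsd := simple_div (fun s hs => C.opp.conj2 s hs.1) C.opp.Δ_mem hΔop hanti hg3 hex
  obtain ⟨b1, b2⟩ := C.opp.bridgeB hg1 hg2 hg3 (List.length_pos_iff.2 hne) hsd
    ((NF_op C).2 hzNF) ((Good_op C).2 hz2) (LC_op.2 hz3)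
    (by simpa [hlz] using a3) (by simpa [hlz] using a4)
  have hh : ((𝒢.rnf z).2.map op).reverse.headD 1 = op (((𝒢.rnf z).2.getLast?).getD 1) := by
    rw [List.headD_eq_head?_getD, List.head?_reverse, List.getLast?_map]
    cases (𝒢.rnf z).2.getLast? <;> rfl
  have hi2 : (op 𝒢.Δ) ^ (𝒢.rnf z).1 * ((𝒢.rnf z).2.map op).reverse.headD 1 *
      (op 𝒢.Δ) ^ (-(𝒢.rnf z).1) = op (𝒢.iotaR z) := by
    rw [hh, op_pow, op_pow, ← op_mul, ← op_mul]
    unfold GarsideGroup.iotaR GarsideGroup.tau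
    rw [mul_assoc]
  rw [hi2] at b2
  refine ⟨by simpa using b1, ?_⟩
  rw [← NF_op C]
  simpa using b2

theorem rightToLeft (𝒢 : GarsideGroup G) {lam : G → ℤ} (C : Core 𝒢.pos 𝒢.Δ lam) (hΔ1 : 𝒢.Δ ≠ 1)
    (x : G) (hx : 𝒢.RightRigid x) : ∃ y, IsConj x y ∧ 𝒢.LeftRigid y := by
  obtain ⟨hne, hrig⟩ := hx
  have hxNF : IsRightNF 𝒢.pos 𝒢.Δ 𝒢.gcdR (𝒢.rnf x).1 (𝒢.rnf x).2 x :=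
    Classical.choose_spec (𝒢.rnf_exists x)
  have hg3 : ∀ a b c, c⁻¹ * a ∈ 𝒢.pos.op → c⁻¹ * b ∈ 𝒢.pos.op →
      c⁻¹ * gop 𝒢.gcdR a b ∈ 𝒢.pos.op := fun a b c =>
    𝒢.dvd_gcdR (unop a) (unop b) (unop c)
  have hh : ((𝒢.rnf x).2.map op).reverse.headD 1 = op (((𝒢.rnf x).2.getLast?).getD 1) := by
    rw [List.headD_eq_head?_getD, List.head?_reverse, List.getLast?_map]
    cases (𝒢.rnf x).2.getLast? <;> rfl
  have hi2 : (op 𝒢.Δ) ^ (𝒢.rnf x).1 * ((𝒢.rnf x).2.map op).reverse.headD 1 *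
      (op 𝒢.Δ) ^ (-(𝒢.rnf x).1) = op (𝒢.iotaR x) := by
    rw [hh, op_pow, op_pow, ← op_mul, ← op_mul]
    unfold GarsideGroup.iotaR GarsideGroup.tau
    rw [mul_assoc]
  have hrig' := (NF_op C).2 hrig
  rw [List.map_cons, List.reverse_cons, ← hi2] at hrig'
  obtain ⟨a1, a2, a3, a4⟩ := C.opp.bridgeA hg3 ((NF_op C).2 hxNF) (by simpa using hne) hrig'.2.2
  obtain ⟨z, hz1, hz2, hz3⟩ := C.opp.main (Int.natCast_nonneg _) a1 a2
  obtain ⟨c, hc⟩ := isConj_iff.1 hz1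
  obtain ⟨y, rfl⟩ : ∃ y, z = op y := ⟨unop z, rfl⟩
  have hc' : (unop c)⁻¹ * x * unop c = y := by
    have := congrArg unop hc
    simpa [mul_assoc] using this
  have hlz : lam y = lam x := by
    rw [← hc', C.lam_mul, C.lam_mul, C.lam_inv]; ring
  refine ⟨y, isConj_iff.2 ⟨(unop c)⁻¹, by rw [inv_inv]; exact hc'⟩, ?_⟩
  have hyNF : IsLeftNF 𝒢.pos 𝒢.Δ 𝒢.gcdL (𝒢.lnf y).1 (𝒢.lnf y).2 y :=
    Classical.choose_spec (𝒢.lnf_exists y)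
  have hsd := simple_div (fun s hs => C.conj2 s hs.1) C.Δ_mem hΔ1 𝒢.pos_antisymm 𝒢.dvd_gcdL
    (fun w => by
      obtain ⟨pl, h⟩ := 𝒢.lnf_exists w
      exact ⟨_, _, h⟩)
  have hio : 𝒢.iotaL y = 𝒢.Δ ^ (𝒢.lnf y).1 * (𝒢.lnf y).2.headD 1 * 𝒢.Δ ^ (-(𝒢.lnf y).1) := by
    unfold GarsideGroup.iotaL GarsideGroup.tau
    rw [neg_neg]
  unfold GarsideGroup.LeftRigid
  rw [hio]
  exact C.bridgeB 𝒢.gcdL_dvd_left 𝒢.gcdL_dvd_right 𝒢.dvd_gcdL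
    (List.length_pos_iff.2 (by simpa using hne)) hsd hyNF ((Good_op C).1 hz2) (RC_op.1 hz3)
    (by simpa [hlz] using a3) (by simpa [hlz] using a4)

end garside

section braid

/-- exponent sum homomorphism -/
noncomputable def expHom (n : ℕ) : BraidGroup n →* Multiplicative ℤ :=
  PresentedGroup.toGroup (rels := braidRels (n - 1)) (f := fun _ => Multiplicative.ofAdd 1) (by
    rintro r (⟨i, j, _, rfl⟩ | ⟨i, j, _, rfl⟩) <;> simp)

/-- exponent sum -/
noncomputable def expSum (n : ℕ) (x : BraidGroup n) : ℤ := Multiplicative.toAdd (expHom n x)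

theorem expSum_mul (n : ℕ) (a b : BraidGroup n) :
    expSum n (a * b) = expSum n a + expSum n b := by
  simp [expSum]

theorem expSum_gen (n : ℕ) (i : Fin (n - 1)) : expSum n (σB n i) = 1 := by
  unfold expSum expHom σB
  rw [PresentedGroup.toGroup.of]
  rfl

theorem expSum_one (n : ℕ) : expSum n 1 = 0 := by simp [expSum]

theorem pos_form (n : ℕ) (a : BraidGroup n)
    (ha : a ∈ Submonoid.closure (Set.range (σB n))) :
    ∃ l : List (Fin (n - 1)), a = (l.map (σB n)).prod ∧ expSum n a = l.length := by
  induction ha using Submonoid.closure_induction with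
  | mem x hx =>
    obtain ⟨i, rfl⟩ := hx
    exact ⟨[i], by simp, by simp [expSum_gen]⟩
  | one => exact ⟨[], by simp, by simp [expSum_one]⟩
  | mul x y _ _ hx hy =>
    obtain ⟨l, rfl, h2⟩ := hx
    obtain ⟨m, rfl, h4⟩ := hy
    exact ⟨l ++ m, by simp, by rw [expSum_mul, h2, h4]; simp⟩

theorem braid_core {n : ℕ} (𝒢 : GarsideGroup (BraidGroup n)) (h𝒢 : IsBraidGarside n 𝒢)
    (hΔ1 : 𝒢.Δ ≠ 1) : Core 𝒢.pos 𝒢.Δ (expSum n) := by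
  have hpf : ∀ a ∈ 𝒢.pos, ∃ l : List (Fin (n - 1)),
      a = (l.map (σB n)).prod ∧ expSum n a = l.length := by
    intro a ha
    rw [h𝒢.1] at ha
    exact pos_form n a ha
  have hc2 : ∀ s, Simple 𝒢.pos 𝒢.Δ s → 𝒢.Δ⁻¹ * s * 𝒢.Δ ∈ 𝒢.pos := by
    intro s hs
    have h1 := (𝒢.divisors_Δ (s⁻¹ * 𝒢.Δ)).2 ⟨hs.2, by
      unfold Garside.RightDvd; convert hs.1 using 1; group⟩
    have := h1.2
    unfold Garside.LeftDvd at this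
    convert this using 1; group
  have hc1 : ∀ s, Simple 𝒢.pos 𝒢.Δ s → 𝒢.Δ * s * 𝒢.Δ⁻¹ ∈ 𝒢.pos := by
    intro s hs
    have h0 := (𝒢.divisors_Δ s).1 hs
    have h1 := (𝒢.divisors_Δ (𝒢.Δ * s⁻¹)).1 ⟨h0.2, by
      unfold Garside.LeftDvd; convert hs.1 using 1; group⟩
    have := h1.2
    unfold Garside.RightDvd at this
    convert this using 1; group
  have hind : ∀ Q : Submonoid (BraidGroup n), (∀ s, Simple 𝒢.pos 𝒢.Δ s → s ∈ Q) → 𝒢.pos ≤ Q := by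
    intro Q hQ a ha
    obtain ⟨⟨p, l⟩, h⟩ := 𝒢.lnf_exists a
    have hp := inf_nonneg hc2 𝒢.Δ_pos hΔ1 𝒢.pos_antisymm 𝒢.dvd_gcdL h ha
    obtain ⟨h1, h2, _⟩ := h
    obtain ⟨k, hk⟩ := Int.eq_ofNat_of_zero_le hp
    simp only at h1 h2 hk
    rw [h1, hk, zpow_natCast]
    exact Q.mul_mem (Q.pow_mem (hQ _ ⟨𝒢.Δ_pos, by simp [LeftDvd]⟩) k)
      (Q.list_prod_mem fun t ht => hQ t (h2 t ht).1)
  have hC1 : ∀ a ∈ 𝒢.pos, 𝒢.Δ * a * 𝒢.Δ⁻¹ ∈ 𝒢.pos :=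
    hind (𝒢.pos.comap (MulAut.conj 𝒢.Δ).toMonoidHom) hc1
  have hC2 : ∀ a ∈ 𝒢.pos, 𝒢.Δ⁻¹ * a * 𝒢.Δ ∈ 𝒢.pos := by
    intro a ha
    have := hind (𝒢.pos.comap (MulAut.conj 𝒢.Δ⁻¹).toMonoidHom) (fun s hs => by
      simpa using hc2 s hs) ha
    simpa using this
  have hfin : ∀ k : ℤ, {a | a ∈ 𝒢.pos ∧ expSum n a = k}.Finite := by
    intro k
    refine ((List.finite_length_eq (Fin (n - 1)) k.toNat).image
      fun l => (l.map (σB n)).prod).subset ?_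
    rintro a ⟨ha, hk⟩
    obtain ⟨l, h1, h2⟩ := hpf a ha
    exact ⟨l, by simp only [Set.mem_ofPred_eq]; omega, h1.symm⟩
  have hinv : ∀ a, expSum n a⁻¹ = - expSum n a := fun a => by simp [expSum]
  have hgen : ∀ i, σB n i ∈ 𝒢.pos := fun i => by
    rw [h𝒢.1]; exact Submonoid.subset_closure ⟨i, rfl⟩
  refine ⟨𝒢.Δ_pos, hC1, hC2, expSum_mul n, ?_, ?_, hfin, ?_, ?_, ?_⟩
  · intro a ha
    obtain ⟨l, _, h⟩ := hpf a ha
    omega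
  · intro a ha h0
    obtain ⟨l, h1, h2⟩ := hpf a ha
    have : l = [] := List.length_eq_zero_iff.1 (by omega)
    rw [h1, this]; simp
  · have hcp : ∀ (k : ℕ) a, a ∈ 𝒢.pos → 𝒢.Δ ^ k * a * (𝒢.Δ ^ k)⁻¹ ∈ 𝒢.pos := by
      intro k a ha
      induction k with
      | zero => simpa using ha
      | succ k ih =>
        convert hC1 _ ih using 1
        rw [pow_succ']; group
    have hF : Finite {a // a ∈ 𝒢.pos ∧ expSum n a = 1} := (hfin 1).to_subtype
    let f : ℕ → (Fin (n - 1) → {a // a ∈ 𝒢.pos ∧ expSum n a = 1}) := fun k i =>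
      ⟨𝒢.Δ ^ k * σB n i * (𝒢.Δ ^ k)⁻¹, hcp k _ (hgen i), by
        rw [expSum_mul, expSum_mul, hinv, expSum_gen]; ring⟩
    have hkey : ∃ k e : ℕ, 0 < e ∧ f k = f (k + e) := by
      obtain ⟨k, k', hne, h⟩ := Finite.exists_ne_map_eq_of_infinite f
      rcases lt_or_gt_of_ne hne with hl | hl
      · exact ⟨k, k' - k, by omega, by rw [h]; congr 1; omega⟩
      · exact ⟨k', k - k', by omega, by rw [← h]; congr 1; omega⟩
    obtain ⟨k, e, he, h⟩ := hkey
    refine ⟨e, he, fun g => ?_⟩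
    have hg : g ∈ Subgroup.centralizer {𝒢.Δ ^ e} := by
      have hle : Subgroup.closure (Set.range (PresentedGroup.of (rels := braidRels (n - 1)))) ≤
          Subgroup.centralizer {𝒢.Δ ^ e} := by
        rw [Subgroup.closure_le]
        rintro _ ⟨i, rfl⟩
        have h1 : 𝒢.Δ ^ k * σB n i * (𝒢.Δ ^ k)⁻¹ =
            𝒢.Δ ^ (k + e) * σB n i * (𝒢.Δ ^ (k + e))⁻¹ :=
          congrArg Subtype.val (congrFun h i)
        have h2 : σB n i = 𝒢.Δ ^ e * σB n i * (𝒢.Δ ^ e)⁻¹ := by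
          have : (𝒢.Δ ^ k)⁻¹ * (𝒢.Δ ^ k * σB n i * (𝒢.Δ ^ k)⁻¹) * 𝒢.Δ ^ k =
            (𝒢.Δ ^ k)⁻¹ * (𝒢.Δ ^ (k + e) * σB n i * (𝒢.Δ ^ (k + e))⁻¹) * 𝒢.Δ ^ k := by rw [h1]
          convert this using 1
          · group
          · rw [pow_add]; group
        rw [SetLike.mem_coe, Subgroup.mem_centralizer_iff]
        intro y hy
        rw [Set.mem_singleton_iff] at hy
        subst hy
        exact (eq_mul_inv_iff_mul_eq.1 h2).symm
      rw [PresentedGroup.closure_range_of] at hle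
      exact hle (Subgroup.mem_top g)
    exact Subgroup.mem_centralizer_iff.1 hg _ rfl
  · intro a b
    exact ⟨𝒢.gcdL a b, 𝒢.gcdL_dvd_left a b, 𝒢.gcdL_dvd_right a b, 𝒢.dvd_gcdL a b⟩
  · intro a b
    exact ⟨𝒢.gcdR a b, 𝒢.gcdR_dvd_left a b, 𝒢.gcdR_dvd_right a b, 𝒢.dvd_gcdR a b⟩

end braid
end GProof

namespace Garside

/-- **Corollary 4.6.** If `x ∈ Bₙ` is a left (resp. right) rigid pseudo-Anosov
braid with `ℓ(x) > 1`, then `x` is conjugate to a right (resp. left) rigid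
braid. -/
theorem pseudoAnosov_rigid_conj {n : ℕ} (𝒢 : GarsideGroup (BraidGroup n))
    (h𝒢 : IsBraidGarside n 𝒢)
    (ρ : BraidGroup n →* MulAut (FreeGroup (Fin n))) (hρ : IsArtinRep n ρ)
    (x : BraidGroup n) (hpA : PseudoAnosov n ρ x) (hx : 1 < 𝒢.len x) :
    (𝒢.LeftRigid x → ∃ y, IsConj x y ∧ 𝒢.RightRigid y) ∧
    (𝒢.RightRigid x → ∃ y, IsConj x y ∧ 𝒢.LeftRigid y) := by
  have hΔ1 : 𝒢.Δ ≠ 1 := by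
    intro h1
    have hxNF : IsLeftNF 𝒢.pos 𝒢.Δ 𝒢.gcdL (𝒢.lnf x).1 (𝒢.lnf x).2 x :=
      Classical.choose_spec (𝒢.lnf_exists x)
    obtain ⟨s, hs⟩ := List.exists_mem_of_length_pos (l := (𝒢.lnf x).2)
      (lt_trans Nat.zero_lt_one hx)
    obtain ⟨⟨h2, h3⟩, h4, _⟩ := hxNF.2.1 s hs
    rw [h1] at h3
    exact h4 (𝒢.pos_antisymm s h2 (by simpa [LeftDvd] using h3))
  have C := GProof.braid_core 𝒢 h𝒢 hΔ1
  exact ⟨GProof.leftToRight 𝒢 C hΔ1 x, GProof.rightToLeft 𝒢 C hΔ1 x⟩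

end Garside
end

section
/- A left rigid or right rigid braid x ∈ B_n can never be periodic; that is, if x is left or right rigid then there are no nonzero integers m, t with x^m = Δ^t. -/
namespace Garside

section Aux

variable {G : Type*} [Group G] (𝒢 : GarsideGroup G)

theorem aux_tau_mul (k : ℤ) (a b : G) : 𝒢.tau k (a * b) = 𝒢.tau k a * 𝒢.tau k b := by
  simp only [GarsideGroup.tau]; group

theorem aux_tau_one (k : ℤ) : 𝒢.tau k 1 = 1 := by
  simp only [GarsideGroup.tau]; group

theorem aux_tau_inv (k : ℤ) (a : G) : 𝒢.tau k a⁻¹ = (𝒢.tau k a)⁻¹ := by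
  simp only [GarsideGroup.tau]; group

theorem aux_tau_tau (j k : ℤ) (a : G) : 𝒢.tau j (𝒢.tau k a) = 𝒢.tau (j + k) a := by
  have h1 : 𝒢.Δ ^ (-(j + k)) = 𝒢.Δ ^ (-j) * 𝒢.Δ ^ (-k) := by rw [← zpow_add]; congr 1; ring
  have h2 : 𝒢.Δ ^ (j + k) = 𝒢.Δ ^ k * 𝒢.Δ ^ j := by rw [← zpow_add]; congr 1; ring
  simp only [GarsideGroup.tau, h1, h2, mul_assoc]

theorem aux_tau_zero (a : G) : 𝒢.tau 0 a = a := by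
  simp [GarsideGroup.tau]

theorem aux_tau_delta (k : ℤ) : 𝒢.tau k 𝒢.Δ = 𝒢.Δ := by
  simp only [GarsideGroup.tau]; group

theorem aux_tau_prod (k : ℤ) (l : List G) : 𝒢.tau k l.prod = (l.map (𝒢.tau k)).prod := by
  induction l with
  | nil => simp [aux_tau_one]
  | cons a l ih => simp [aux_tau_mul, ih]

/-- conjugating a simple element by `Δ` gives a positive element -/
theorem aux_tau_simple (s : G) (hs : Simple 𝒢.pos 𝒢.Δ s) :
    𝒢.tau 1 s ∈ 𝒢.pos ∧ 𝒢.tau (-1) s ∈ 𝒢.pos := by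
  have hs2 := (𝒢.divisors_Δ s).1 hs
  constructor
  · -- `s' = s⁻¹ Δ` is a right divisor, hence a left divisor
    have h := (𝒢.divisors_Δ (s⁻¹ * 𝒢.Δ)).2 ⟨hs.2, by
      have e : 𝒢.Δ * (s⁻¹ * 𝒢.Δ)⁻¹ = s := by group
      simpa only [RightDvd, e] using hs.1⟩
    have h2 := h.2
    have e : (s⁻¹ * 𝒢.Δ)⁻¹ * 𝒢.Δ = 𝒢.tau 1 s := by simp only [GarsideGroup.tau]; group
    simpa only [LeftDvd, e] using h2
  · have h := (𝒢.divisors_Δ (𝒢.Δ * s⁻¹)).1 ⟨hs2.2, by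
      have e : (𝒢.Δ * s⁻¹)⁻¹ * 𝒢.Δ = s := by group
      simpa only [LeftDvd, e] using hs.1⟩
    have h2 := h.2
    have e : 𝒢.Δ * (𝒢.Δ * s⁻¹)⁻¹ = 𝒢.tau (-1) s := by simp only [GarsideGroup.tau]; group
    simpa only [RightDvd, e] using h2

theorem aux_dvd_trans {a b c : G} (h1 : LeftDvd 𝒢.pos a b) (h2 : LeftDvd 𝒢.pos b c) :
    LeftDvd 𝒢.pos a c := by
  have := 𝒢.pos.mul_mem h1 h2
  have e : a⁻¹ * b * (b⁻¹ * c) = a⁻¹ * c := by group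
  simpa only [LeftDvd, e] using this

theorem aux_dvd_antisymm {a b : G} (h1 : LeftDvd 𝒢.pos a b) (h2 : LeftDvd 𝒢.pos b a) :
    a = b := by
  have := 𝒢.pos_antisymm (a⁻¹ * b) h1 (by simpa [LeftDvd] using h2)
  exact inv_mul_eq_one.1 this

theorem aux_rdvd_antisymm {a b : G} (h1 : RightDvd 𝒢.pos a b) (h2 : RightDvd 𝒢.pos b a) :
    a = b := by
  have := 𝒢.pos_antisymm (b * a⁻¹) h1 (by simpa [RightDvd] using h2)
  exact (mul_inv_eq_one.1 this).symm

/-- common left divisors of a weighted product and `Δ` divide the first factor -/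
theorem aux_head (l : List G) (a : G) (hs : ∀ s ∈ a :: l, Simple 𝒢.pos 𝒢.Δ s)
    (hc : (a :: l).IsChain (fun s t => 𝒢.gcdL (s * t) 𝒢.Δ = s)) (c : G)
    (h1 : LeftDvd 𝒢.pos c (a :: l).prod) (h2 : LeftDvd 𝒢.pos c 𝒢.Δ) : LeftDvd 𝒢.pos c a := by
  induction l generalizing a c with
  | nil => simpa using h1
  | cons b l ih =>
    have hab : 𝒢.gcdL (a * b) 𝒢.Δ = a := (List.isChain_cons_cons.1 hc).1
    rw [← hab]
    refine 𝒢.dvd_gcdL _ _ _ ?_ h2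
    have h3 : LeftDvd 𝒢.pos c (a * 𝒢.Δ) := by
      refine aux_dvd_trans 𝒢 h2 ?_
      have := (aux_tau_simple 𝒢 a (hs a (by simp))).1
      simpa [LeftDvd, GarsideGroup.tau, mul_assoc] using this
    -- translate by `a`
    have h4 : LeftDvd 𝒢.pos (a⁻¹ * c) (𝒢.gcdL (b :: l).prod 𝒢.Δ) := by
      apply 𝒢.dvd_gcdL
      · have e : (a⁻¹ * c)⁻¹ * (b :: l).prod = c⁻¹ * (a :: b :: l).prod := by simp [mul_assoc]
        simpa only [LeftDvd, e] using h1
      · have e : (a⁻¹ * c)⁻¹ * 𝒢.Δ = c⁻¹ * (a * 𝒢.Δ) := by simp [mul_assoc]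
        simpa only [LeftDvd, e] using h3
    have h5 : LeftDvd 𝒢.pos (𝒢.gcdL (b :: l).prod 𝒢.Δ) b :=
      ih b (fun s hs' => hs s (List.mem_cons_of_mem _ hs')) (List.isChain_cons_cons.1 hc).2 _
        (𝒢.gcdL_dvd_left _ _) (𝒢.gcdL_dvd_right _ _)
    have h6 := aux_dvd_trans 𝒢 h4 h5
    have e : (a⁻¹ * c)⁻¹ * b = c⁻¹ * (a * b) := by simp [mul_assoc]
    simpa only [LeftDvd, e] using h6

theorem aux_pos_nf (a : G) (ha : a ∈ 𝒢.pos) :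
    ∃ (p : ℕ) (l : List G), (∀ s ∈ l, Simple 𝒢.pos 𝒢.Δ s) ∧ a = 𝒢.Δ ^ p * l.prod := by
  obtain ⟨⟨p, l⟩, hx, hs, hc⟩ := 𝒢.lnf_exists a
  dsimp only at hx hs hc
  rcases le_or_gt 0 p with hp | hp
  · lift p to ℕ using hp
    exact ⟨p, l, fun s h => (hs s h).1, by simpa using hx⟩
  · obtain ⟨k, rfl⟩ : ∃ k : ℕ, p = -(k + 1 : ℤ) := ⟨(-p - 1).toNat, by omega⟩
    cases l with
    | nil =>
      refine ⟨0, [], by simp, ?_⟩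
      have : a = 1 := by
        refine 𝒢.pos_antisymm a ha ?_
        have e : a⁻¹ = 𝒢.Δ ^ (k + 1) := by
          rw [hx]; simp only [List.prod_nil, mul_one, ← zpow_neg, neg_neg]; norm_cast
        rw [e]; exact 𝒢.pos.pow_mem 𝒢.Δ_pos _
      simpa using this
    | cons b l =>
      exfalso
      have hb := hs b (by simp)
      have e : 𝒢.Δ⁻¹ * (b :: l).prod = 𝒢.Δ ^ k * a := by
        rw [hx, ← mul_assoc, ← zpow_natCast, ← zpow_add]
        congr 1
        rw [← zpow_neg_one]; congr 1; ring
      have h1 : LeftDvd 𝒢.pos 𝒢.Δ (b :: l).prod := by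
        simp only [LeftDvd, e]
        exact 𝒢.pos.mul_mem (𝒢.pos.pow_mem 𝒢.Δ_pos _) ha
      have h2 := aux_head 𝒢 l b (fun s h => (hs s h).1) hc 𝒢.Δ h1 (by simp [LeftDvd])
      exact hb.2.2 (aux_dvd_antisymm 𝒢 hb.1.2 h2)

theorem aux_tau_pos_unit (e : ℤ) (he : e = 1 ∨ e = -1) (a : G) (ha : a ∈ 𝒢.pos) :
    𝒢.tau e a ∈ 𝒢.pos := by
  obtain ⟨p, l, hl, rfl⟩ := aux_pos_nf 𝒢 a ha
  have h : 𝒢.tau e (𝒢.Δ ^ p) = 𝒢.Δ ^ p := by simp only [GarsideGroup.tau]; group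
  rw [aux_tau_mul, h, aux_tau_prod]
  refine 𝒢.pos.mul_mem (𝒢.pos.pow_mem 𝒢.Δ_pos _) (𝒢.pos.list_prod_mem ?_)
  intro s hs
  obtain ⟨s', hs', rfl⟩ := List.mem_map.1 hs
  have := aux_tau_simple 𝒢 s' (hl s' hs')
  rcases he with rfl | rfl
  exacts [this.1, this.2]

theorem aux_tau_pos (k : ℤ) (a : G) (ha : a ∈ 𝒢.pos) : 𝒢.tau k a ∈ 𝒢.pos := by
  induction k using Int.induction_on with
  | zero => simpa [aux_tau_zero] using ha
  | succ i ih =>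
    have := aux_tau_pos_unit 𝒢 1 (Or.inl rfl) _ ih
    rwa [aux_tau_tau, add_comm] at this
  | pred i ih =>
    have := aux_tau_pos_unit 𝒢 (-1) (Or.inr rfl) _ ih
    rwa [aux_tau_tau, add_comm] at this

theorem aux_tau_dvd (k : ℤ) {a b : G} (h : LeftDvd 𝒢.pos a b) :
    LeftDvd 𝒢.pos (𝒢.tau k a) (𝒢.tau k b) := by
  have := aux_tau_pos 𝒢 k _ h
  rwa [aux_tau_mul, aux_tau_inv] at this

theorem aux_tau_rdvd (k : ℤ) {a b : G} (h : RightDvd 𝒢.pos a b) :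
    RightDvd 𝒢.pos (𝒢.tau k a) (𝒢.tau k b) := by
  have := aux_tau_pos 𝒢 k _ h
  rwa [aux_tau_mul, aux_tau_inv] at this

theorem aux_tau_cancel (k : ℤ) (a : G) : 𝒢.tau k (𝒢.tau (-k) a) = a := by
  rw [aux_tau_tau, add_neg_cancel, aux_tau_zero]

theorem aux_tau_cancel' (k : ℤ) (a : G) : 𝒢.tau (-k) (𝒢.tau k a) = a := by
  rw [aux_tau_tau, neg_add_cancel, aux_tau_zero]

theorem aux_tau_gcdL (k : ℤ) (a b : G) :
    𝒢.gcdL (𝒢.tau k a) (𝒢.tau k b) = 𝒢.tau k (𝒢.gcdL a b) := by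
  apply aux_dvd_antisymm 𝒢
  · have h1 := aux_tau_dvd 𝒢 (-k) (𝒢.gcdL_dvd_left (𝒢.tau k a) (𝒢.tau k b))
    have h2 := aux_tau_dvd 𝒢 (-k) (𝒢.gcdL_dvd_right (𝒢.tau k a) (𝒢.tau k b))
    rw [aux_tau_cancel'] at h1 h2
    have := aux_tau_dvd 𝒢 k (𝒢.dvd_gcdL _ _ _ h1 h2)
    rwa [aux_tau_cancel] at this
  · exact 𝒢.dvd_gcdL _ _ _ (aux_tau_dvd 𝒢 k (𝒢.gcdL_dvd_left _ _))
      (aux_tau_dvd 𝒢 k (𝒢.gcdL_dvd_right _ _))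

theorem aux_tau_gcdR (k : ℤ) (a b : G) :
    𝒢.gcdR (𝒢.tau k a) (𝒢.tau k b) = 𝒢.tau k (𝒢.gcdR a b) := by
  apply aux_rdvd_antisymm 𝒢
  · have h1 := aux_tau_rdvd 𝒢 (-k) (𝒢.gcdR_dvd_left (𝒢.tau k a) (𝒢.tau k b))
    have h2 := aux_tau_rdvd 𝒢 (-k) (𝒢.gcdR_dvd_right (𝒢.tau k a) (𝒢.tau k b))
    rw [aux_tau_cancel'] at h1 h2
    have := aux_tau_rdvd 𝒢 k (𝒢.dvd_gcdR _ _ _ h1 h2)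
    rwa [aux_tau_cancel] at this
  · exact 𝒢.dvd_gcdR _ _ _ (aux_tau_rdvd 𝒢 k (𝒢.gcdR_dvd_left _ _))
      (aux_tau_rdvd 𝒢 k (𝒢.gcdR_dvd_right _ _))

theorem aux_tau_weightL (k : ℤ) {s t : G} (h : 𝒢.gcdL (s * t) 𝒢.Δ = s) :
    𝒢.gcdL (𝒢.tau k s * 𝒢.tau k t) 𝒢.Δ = 𝒢.tau k s := by
  have := aux_tau_gcdL 𝒢 k (s * t) 𝒢.Δ
  rwa [aux_tau_mul, aux_tau_delta, h] at this

theorem aux_tau_weightR (k : ℤ) {s t : G} (h : 𝒢.gcdR (s * t) 𝒢.Δ = t) :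
    𝒢.gcdR (𝒢.tau k s * 𝒢.tau k t) 𝒢.Δ = 𝒢.tau k t := by
  have := aux_tau_gcdR 𝒢 k (s * t) 𝒢.Δ
  rwa [aux_tau_mul, aux_tau_delta, h] at this

theorem aux_tau_proper (k : ℤ) {s : G} (h : Simple 𝒢.pos 𝒢.Δ s ∧ s ≠ 1 ∧ s ≠ 𝒢.Δ) :
    Simple 𝒢.pos 𝒢.Δ (𝒢.tau k s) ∧ 𝒢.tau k s ≠ 1 ∧ 𝒢.tau k s ≠ 𝒢.Δ := by
  refine ⟨⟨aux_tau_pos 𝒢 k s h.1.1, ?_⟩, ?_, ?_⟩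
  · have := aux_tau_dvd 𝒢 k h.1.2
    rwa [aux_tau_delta] at this
  · intro e
    apply h.2.1
    rw [← aux_tau_cancel' 𝒢 k s, e, aux_tau_one]
  · intro e
    apply h.2.2
    rw [← aux_tau_cancel' 𝒢 k s, e, aux_tau_delta]

/-- factors of the left normal form of the `m`-th power -/
def powListL (p : ℤ) (l : List G) : ℕ → List G
  | 0 => []
  | m + 1 => l.map (𝒢.tau (p * m)) ++ powListL p l m

/-- factors of the right normal form of the `m`-th power -/
def powListR (p : ℤ) (l : List G) : ℕ → List G
  | 0 => []
  | m + 1 => powListR p l m ++ l.map (𝒢.tau (-(p * m)))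

theorem aux_powL (x : G) (p : ℤ) (l : List G) (hl : l ≠ [])
    (hx : IsLeftNF 𝒢.pos 𝒢.Δ 𝒢.gcdL p l x)
    (hr : ∀ a ∈ l.getLast?, ∀ b ∈ l.head?,
      𝒢.gcdL (a * 𝒢.tau (-p) b) 𝒢.Δ = a) (m : ℕ) :
    IsLeftNF 𝒢.pos 𝒢.Δ 𝒢.gcdL (p * m) (powListL 𝒢 p l m) (x ^ m) := by
  obtain ⟨h1, h2, h3⟩ := hx
  induction m with
  | zero => exact ⟨by simp [powListL], by simp [powListL], List.isChain_nil⟩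
  | succ m ih =>
    obtain ⟨i1, i2, i3⟩ := ih
    refine ⟨?_, ?_, ?_⟩
    · have e : p * ((m + 1 : ℕ) : ℤ) = p + p * m := by push_cast; ring
      rw [pow_succ', i1, e, zpow_add, powListL, List.prod_append, ← aux_tau_prod]
      nth_rewrite 1 [h1]
      simp only [GarsideGroup.tau, zpow_neg, mul_assoc, mul_inv_cancel_left]
    · intro s hs
      rcases List.mem_append.1 hs with hs | hs
      · obtain ⟨s', hs', rfl⟩ := List.mem_map.1 hs
        exact aux_tau_proper 𝒢 _ (h2 s' hs')
      · exact i2 s hs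
    · refine List.isChain_append.2 ⟨?_, i3, ?_⟩
      · exact (List.isChain_map _).2 (h3.imp fun a b hab => aux_tau_weightL 𝒢 _ hab)
      · intro a ha b hb
        cases m with
        | zero => simp [powListL] at hb
        | succ k =>
          rw [List.getLast?_map] at ha
          obtain ⟨a', ha', rfl⟩ := Option.mem_map.1 ha
          rw [powListL, List.head?_append_of_ne_nil _ (by simpa using hl), List.head?_map] at hb
          obtain ⟨b', hb', rfl⟩ := Option.mem_map.1 hb
          have := aux_tau_weightL 𝒢 (p * ((k + 1 : ℕ) : ℤ)) (hr a' ha' b' hb')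
          rw [aux_tau_tau] at this
          have e : p * ((k + 1 : ℕ) : ℤ) + -p = p * k := by push_cast; ring
          rwa [e] at this

theorem aux_powR (x : G) (p : ℤ) (l : List G) (hl : l ≠ [])
    (hx : IsRightNF 𝒢.pos 𝒢.Δ 𝒢.gcdR p l x)
    (hr : ∀ a ∈ l.getLast?, ∀ b ∈ l.head?,
      𝒢.gcdR (𝒢.tau p a * b) 𝒢.Δ = b) (m : ℕ) :
    IsRightNF 𝒢.pos 𝒢.Δ 𝒢.gcdR (p * m) (powListR 𝒢 p l m) (x ^ m) := by
  obtain ⟨h1, h2, h3⟩ := hx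
  induction m with
  | zero => exact ⟨by simp [powListR], by simp [powListR], List.isChain_nil⟩
  | succ m ih =>
    obtain ⟨i1, i2, i3⟩ := ih
    refine ⟨?_, ?_, ?_⟩
    · have e : p * ((m + 1 : ℕ) : ℤ) = p * m + p := by push_cast; ring
      rw [pow_succ, i1, e, zpow_add, powListR, List.prod_append, ← aux_tau_prod]
      nth_rewrite 1 [h1]
      simp only [GarsideGroup.tau, zpow_neg, mul_assoc, inv_mul_cancel_left, neg_neg, inv_inv]
    · intro s hs
      rcases List.mem_append.1 hs with hs | hs
      · exact i2 s hs
      · obtain ⟨s', hs', rfl⟩ := List.mem_map.1 hs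
        exact aux_tau_proper 𝒢 _ (h2 s' hs')
    · refine List.isChain_append.2 ⟨i3, ?_, ?_⟩
      · exact (List.isChain_map _).2 (h3.imp fun a b hab => aux_tau_weightR 𝒢 _ hab)
      · intro a ha b hb
        cases m with
        | zero => simp [powListR] at ha
        | succ k =>
          rw [List.head?_map] at hb
          obtain ⟨b', hb', rfl⟩ := Option.mem_map.1 hb
          rw [powListR, List.getLast?_append_of_ne_nil _ (by simpa using hl),
            List.getLast?_map] at ha
          obtain ⟨a', ha', rfl⟩ := Option.mem_map.1 ha
          have := aux_tau_weightR 𝒢 (-(p * ((k + 1 : ℕ) : ℤ))) (hr a' ha' b' hb')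
          rw [aux_tau_tau] at this
          have e : -(p * ((k + 1 : ℕ) : ℤ)) + p = -(p * k) := by push_cast; ring
          rwa [e] at this

theorem aux_left (x : G) (hx : 𝒢.LeftRigid x) (m : ℕ) (t : ℤ)
    (h : x ^ (m + 1) = 𝒢.Δ ^ t) : False := by
  obtain ⟨hl, -, -, hc⟩ := hx
  have hnf : IsLeftNF 𝒢.pos 𝒢.Δ 𝒢.gcdL (𝒢.lnf x).1 (𝒢.lnf x).2 x :=
    Classical.choose_spec (𝒢.lnf_exists x)
  have hp := aux_powL 𝒢 x _ _ hl hnf (by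
    intro a ha b hb
    have := (List.isChain_append.1 hc).2.2 a ha (𝒢.iotaL x) (by simp)
    have e : (𝒢.lnf x).2.headD 1 = b := by
      rw [List.headD_eq_head?_getD, Option.mem_def.1 hb]; rfl
    rwa [GarsideGroup.iotaL, e] at this) (m + 1)
  rw [h] at hp
  have hq : IsLeftNF 𝒢.pos 𝒢.Δ 𝒢.gcdL t [] (𝒢.Δ ^ t) := ⟨by simp, by simp, List.isChain_nil⟩
  have := (𝒢.lnf_unique _ _ _ _ _ hp hq).2
  simp [powListL, hl] at this

theorem aux_right (x : G) (hx : 𝒢.RightRigid x) (m : ℕ) (t : ℤ)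
    (h : x ^ (m + 1) = 𝒢.Δ ^ t) : False := by
  obtain ⟨hl, -, -, hc⟩ := hx
  have hnf : IsRightNF 𝒢.pos 𝒢.Δ 𝒢.gcdR (𝒢.rnf x).1 (𝒢.rnf x).2 x :=
    Classical.choose_spec (𝒢.rnf_exists x)
  have hp := aux_powR 𝒢 x _ _ hl hnf (by
    intro a ha b hb
    have := (List.isChain_cons.1 hc).1 b hb
    have e : (𝒢.rnf x).2.getLast?.getD 1 = a := by
      rw [Option.mem_def.1 ha]; rfl
    rwa [GarsideGroup.iotaR, e] at this) (m + 1)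
  rw [h] at hp
  have hq : IsRightNF 𝒢.pos 𝒢.Δ 𝒢.gcdR t [] (𝒢.Δ ^ t) := ⟨by simp, by simp, List.isChain_nil⟩
  have := (𝒢.rnf_unique _ _ _ _ _ hp hq).2
  simp [powListR, hl] at this

end Aux

/-- **Lemma 4.7.** A left or right rigid braid can never be periodic: if
`x ∈ Bₙ` is left or right rigid, there are no nonzero integers `m, t` with
`x^m = Δ^t`. -/
theorem rigid_not_periodic {n : ℕ} (𝒢 : GarsideGroup (BraidGroup n))
    (h𝒢 : IsBraidGarside n 𝒢) (x : BraidGroup n)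
    (hx : 𝒢.LeftRigid x ∨ 𝒢.RightRigid x) :
    ¬ ∃ m t : ℤ, m ≠ 0 ∧ t ≠ 0 ∧ x ^ m = 𝒢.Δ ^ t := by
  rintro ⟨m, t, hm, -, h⟩
  have key : ∀ (k : ℕ) (s : ℤ), x ^ (k + 1) = 𝒢.Δ ^ s → False := by
    intro k s hk
    rcases hx with hx | hx
    · exact aux_left 𝒢 x hx k s hk
    · exact aux_right 𝒢 x hx k s hk
  rcases lt_or_gt_of_ne hm with hm | hm
  · obtain ⟨k, rfl⟩ : ∃ k : ℕ, m = -((k + 1 : ℕ) : ℤ) := ⟨(-m - 1).toNat, by omega⟩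
    refine key k (-t) ?_
    rw [zpow_neg, ← h, zpow_neg, inv_inv, zpow_natCast]
  · obtain ⟨k, rfl⟩ : ∃ k : ℕ, m = ((k + 1 : ℕ) : ℤ) := ⟨(m - 1).toNat, by omega⟩
    refine key k t ?_
    rw [← h, zpow_natCast]

end Garside
end

section
/- Let x ∈ B_n be a left rigid braid with ℓ(x) = r > 1. Then there exists an integer t ≥ 0 such that c_R^{2rt}(x) is right rigid, and if c_R^{2rt}(x) and c_R^{2rt'}(x) are both right rigid for integers t, t' ≥ 0, then c_R^{2rt}(x) = c_R^{2rt'}(x). Hence the map Φ(x) = c_R^{2rt}(x), for any t with c_R^{2rt}(x) right rigid, is well defined. -/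
namespace Garside
namespace Ab

variable {G : Type*} [Group G] {P : Submonoid G} {D : G}

/-- The cone is invariant under conjugation by powers of `D`. -/
def CInv (P : Submonoid G) (D : G) : Prop := ∀ (e : ℤ) (a : G), a ∈ P → D ^ e * a * D ^ (-e) ∈ P

theorem mem_eq {a b : G} (h : a ∈ P) (e : b = a) : b ∈ P := e ▸ h

theorem zpow_mem_of {D : G} (hD : D ∈ P) {e : ℤ} (he : 0 ≤ e) : D ^ e ∈ P := by
  obtain ⟨k, rfl⟩ := Int.eq_ofNat_of_zero_le he
  rw [zpow_natCast]; exact pow_mem hD k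

/-! ### Left-hand side -/

theorem head_le (hD : D ∈ P) (hc : CInv P D) (l : List G) : ∀ a : G,
    (∀ s ∈ a :: l, s ∈ P ∧ LeftDvd P s D) →
    (a :: l).IsChain (fun s t => ∀ u, LeftDvd P u (s * t) → LeftDvd P u D → LeftDvd P u s) →
    ∀ u, LeftDvd P u (a :: l).prod → LeftDvd P u D → LeftDvd P u a := by
  induction l with
  | nil => intro a _ _ u h _; simpa using h
  | cons b l ih =>
    intro a hs hch u hu huD
    rw [List.isChain_cons_cons] at hch
    apply hch.1 u _ huD
    have h1 := ih b (fun s h => hs s (List.mem_cons_of_mem _ h)) hch.2 (a⁻¹ * u)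
      (by unfold LeftDvd at *; rw [List.prod_cons] at hu; exact mem_eq hu (by group))
      (by
        unfold LeftDvd at *
        have := hc (-1) a (hs a (by simp)).1
        exact mem_eq (mul_mem huD this) (by group))
    unfold LeftDvd at *
    exact mem_eq h1 (by group)

theorem prefix_le (hD : D ∈ P) (hc : CInv P D) (t : G) (l : List G) :
    (∀ s ∈ l ++ [t], s ∈ P ∧ LeftDvd P s D) →
    (l ++ [t]).IsChain (fun s t => ∀ u, LeftDvd P u (s * t) → LeftDvd P u D → LeftDvd P u s) →
    ∀ u, LeftDvd P u (l ++ [t]).prod → LeftDvd P u (D ^ (l.length : ℤ)) →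
      LeftDvd P u l.prod := by
  induction l with
  | nil => intro _ _ u _ h2; simpa using h2
  | cons a l ih =>
    intro hs hch u hu huD
    have hl : (l ++ [t]).prod ∈ P := Submonoid.list_prod_mem _ (fun s h => (hs s (by simp at h ⊢; tauto)).1)
    have h1 := head_le hD hc (l ++ [t]) a hs hch (u * D ^ (-(l.length : ℤ)))
      (by
        unfold LeftDvd at *
        have h := hc (l.length : ℤ) _ hu
        have h2 := mul_mem h (zpow_mem_of hD (Int.natCast_nonneg l.length))
        exact mem_eq h2 (by simp only [List.cons_append]; group))
      (by
        unfold LeftDvd at *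
        have h := hc (l.length : ℤ) _ huD
        refine mem_eq h ?_
        simp only [List.length_cons]; push_cast; group)
    have hch' : (l ++ [t]).IsChain (fun s t => ∀ u, LeftDvd P u (s * t) → LeftDvd P u D → LeftDvd P u s) := by
      have := hch.tail; simpa using this
    have h3 := ih (fun s h => hs s (List.mem_cons_of_mem _ h)) hch' (a⁻¹ * u)
      (by unfold LeftDvd at *; rw [List.cons_append, List.prod_cons] at hu; exact mem_eq hu (by group))
      (by
        unfold LeftDvd at *
        have h := hc (-(l.length : ℤ)) _ h1
        exact mem_eq h (by group))
    unfold LeftDvd at *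
    rw [List.prod_cons]
    exact mem_eq h3 (by group)

/-- Left coprimality, the consequence of left rigidity that is used. -/
def Lcop (P : Submonoid G) (D x : G) (p r : ℤ) : Prop :=
  ∀ s, LeftDvd P s (x * D ^ (-p)) → LeftDvd P s (x⁻¹ * D ^ (p + r)) → LeftDvd P s D →
    LeftDvd P s 1

theorem Lcop.inv {x : G} {p r : ℤ} (h : Lcop P D x p r) : Lcop P D x⁻¹ (-(p + r)) r := by
  intro s h1 h2 h3
  refine h s ?_ ?_ h3
  · refine mem_eq h2 ?_
    rw [inv_inv]; congr 3; ring
  · refine mem_eq h1 ?_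
    congr 3; ring

theorem Apos (hc : CInv P D) {x : G} {p : ℤ} (hX : x * D ^ (-p) ∈ P) (q : ℕ) :
    x ^ (q : ℤ) * D ^ (-p * q) ∈ P := by
  induction q with
  | zero => simp
  | succ q ih =>
    refine mem_eq (mul_mem hX (hc p _ ih)) ?_
    push_cast; group

theorem Apow (hD : D ∈ P) (hc : CInv P D) {x : G} {p r : ℤ} (hr : 1 ≤ r)
    (hX : x * D ^ (-p) ∈ P) (h : Lcop P D x p r) (q : ℕ) :
    ∀ s, LeftDvd P s (x ^ (q : ℤ) * D ^ (-p * q)) → LeftDvd P s D → LeftDvd P s (x * D ^ (-p)) := by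
  induction q with
  | zero =>
    intro s h1 h2
    unfold LeftDvd at *
    exact mem_eq (mul_mem h1 hX) (by simp)
  | succ q ih =>
    intro s h1 h2
    have hu2 : LeftDvd P (x⁻¹ * s * D ^ p) D := by
      unfold LeftDvd at *
      have h4 := hc (-p) _ (mul_mem h2 (hc (-1) _ hX))
      exact mem_eq h4 (by group)
    have hu1 := ih (x⁻¹ * s * D ^ p)
      (by
        unfold LeftDvd at *
        refine mem_eq (hc (-p) _ h1) ?_
        push_cast; group) hu2
    have hu3 : LeftDvd P (x⁻¹ * s * D ^ p) (x⁻¹ * D ^ (p + r)) := by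
      unfold LeftDvd at *
      have h4 := hc (-p) _ (mul_mem h2 (zpow_mem_of hD (show 0 ≤ r - 1 by omega)))
      exact mem_eq h4 (by group)
    have h5 := h _ hu1 hu3 hu2
    unfold LeftDvd at *
    exact mem_eq (hc p _ h5) (by group)

theorem descent (hD : D ∈ P) (hc : CInv P D) {x : G} {p r : ℤ} (hr : 1 ≤ r)
    (hX : x * D ^ (-p) ∈ P) (hY : x⁻¹ * D ^ (p + r) ∈ P) (h : Lcop P D x p r) (q k : ℕ) (e : G) (c : ℤ)
    (h1 : LeftDvd P e (x ^ (q : ℤ) * D ^ (-p * q) * D ^ c))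
    (h2 : LeftDvd P e (x ^ (-k : ℤ) * D ^ ((p + r) * k) * D ^ c)) :
    LeftDvd P e (D ^ c) := by
  have key : ∀ j : ℕ, LeftDvd P e (D ^ (c + j)) → LeftDvd P e (D ^ c) := by
    intro j
    induction j with
    | zero => intro h; simpa using h
    | succ j ih =>
      intro h3
      apply ih
      have hj : (0 : ℤ) ≤ j := Int.natCast_nonneg j
      have a1 : LeftDvd P (e * D ^ (-(c + j))) D := by
        unfold LeftDvd at *
        refine mem_eq (hc (c + j) _ h3) ?_
        push_cast; group
      have a2 := Apow hD hc hr hX h q (e * D ^ (-(c + j)))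
        (by
          unfold LeftDvd at *
          exact mem_eq (mul_mem (hc (c + j) _ h1) (zpow_mem_of hD hj)) (by group)) a1
      have a3 := Apow hD hc hr (x := x⁻¹) (p := -(p + r)) (by rw [neg_neg]; exact hY) h.inv k (e * D ^ (-(c + j)))
        (by
          unfold LeftDvd at *
          exact mem_eq (mul_mem (hc (c + j) _ h2) (zpow_mem_of hD hj)) (by group)) a1
      rw [neg_neg] at a3
      have a4 := h _ a2 a3 a1
      unfold LeftDvd at *
      exact mem_eq (hc (-(c + j)) _ a4) (by group)
  obtain ⟨R, hR⟩ := Int.eq_ofNat_of_zero_le (show 0 ≤ r by omega)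
  apply key (R * k)
  have a := Apos hc hX k
  unfold LeftDvd at *
  refine mem_eq (mul_mem h2 (hc (-(p + r) * k - c) _ a)) ?_
  push_cast
  rw [show (R : ℤ) = r from hR.symm]
  group

theorem Lcop_of_chain (hD : D ∈ P) (hc : CInv P D) {x : G} {p : ℤ} {l : List G} {i : G}
    (hx : x = D ^ p * l.prod)
    (hs : ∀ s ∈ l ++ [i], s ∈ P ∧ LeftDvd P s D)
    (hch : (l ++ [i]).IsChain (fun s t => ∀ u, LeftDvd P u (s * t) → LeftDvd P u D → LeftDvd P u s))
    (hi : ∀ a m, l = a :: m → i = D ^ p * a * D ^ (-p)) (hl : l ≠ []) :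
    Lcop P D x p l.length := by
  intro s h1 h2 h3
  have hsi : LeftDvd P s i := by
    obtain ⟨a, m, rfl⟩ := List.exists_cons_of_ne_nil hl
    rw [hi a m rfl]
    have := head_le hD hc m a (fun s h => hs s (List.mem_append_left _ h))
      (hch.left_of_append) (D ^ (-p) * s * D ^ p)
      (by unfold LeftDvd at *; rw [hx] at h1; exact mem_eq (hc (-p) _ h1) (by group))
      (by unfold LeftDvd at *; exact mem_eq (hc (-p) _ h3) (by group))
    unfold LeftDvd at *
    exact mem_eq (hc p _ this) (by group)
  have := prefix_le hD hc i l hs hch (l.prod * s)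
    (by unfold LeftDvd at *; rw [List.prod_append, List.prod_singleton]; exact mem_eq hsi (by group))
    (by unfold LeftDvd at *; rw [hx] at h2; exact mem_eq h2 (by group))
  unfold LeftDvd at *
  exact mem_eq this (by group)

/-- Exactness of the infimum along conjugates. -/
theorem exact_inf (hD : D ∈ P) (hc : CInv P D) (h2 : ∀ g, D ^ 2 * g = g * D ^ 2) {x : G} {p r : ℤ}
    (hr : 1 ≤ r) (hX : x * D ^ (-p) ∈ P) (h : Lcop P D x p r) (v : G) (i : ℕ) (hv : v ∈ P)
    (hv2 : D ^ (2 * i : ℤ) * v⁻¹ ∈ P) (hz : D ^ (-p - 1) * (v * x * v⁻¹) ∈ P) :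
    LeftDvd P D (x * D ^ (-p)) := by
  have hcen : ∀ (k : ℤ) (g : G), D ^ (2 * k) * g = g * D ^ (2 * k) := by
    intro k g
    have : Commute (D ^ (2 : ℤ)) g := by
      have := h2 g
      rw [zpow_ofNat]; exact this
    rw [zpow_mul]; exact this.zpow_left k
  set z := v * x * v⁻¹ with hzdef
  have hpow : ∀ m : ℕ, D ^ ((-p - 1) * m) * z ^ (m : ℤ) ∈ P := by
    intro m
    induction m with
    | zero => simp
    | succ m ih =>
      refine mem_eq (mul_mem (hc (-p - 1) _ ih) hz) ?_
      push_cast; group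
  have hzm : ∀ m : ℤ, z ^ m = v * x ^ m * v⁻¹ := by
    intro m; rw [hzdef, conj_zpow]
  have h3 := hpow (2 * i + 2)
  rw [hzm] at h3
  have h4 := mul_mem (mul_mem hD (mul_mem hv2 h3)) hv
  apply Apow hD hc hr hX h (2 * i + 2) D _ (by unfold LeftDvd; simp)
  unfold LeftDvd
  refine mem_eq h4 ?_
  have e1 : D ^ (-p * ((2 * i + 2 : ℕ) : ℤ)) = D ^ (2 * (-p * (i + 1))) := by congr 1; push_cast; ring
  have e2 : D ^ ((-p - 1) * ((2 * i + 2 : ℕ) : ℤ)) = D ^ (2 * ((-p - 1) * (i + 1))) := by congr 1; push_cast; ring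
  rw [e1, e2]
  have c1 := hcen (-p * (i + 1)) (x ^ ((2 * i + 2 : ℕ) : ℤ))
  have c2 := hcen ((-p - 1) * (i + 1)) v⁻¹
  rw [← c1]
  simp only [mul_assoc]
  rw [← mul_assoc v⁻¹ (D ^ _), ← c2]
  simp only [mul_assoc]
  group

end Ab
end Garside
namespace Garside
namespace Ab

variable {G : Type*} [Group G]

/-- `D²` is central. -/
def Cen (D : G) : Prop := ∀ (k : ℤ) (g : G), D ^ (2 * k) * g = g * D ^ (2 * k)

/-- Finiteness of the intervals `[1, D^k]`. -/
def Fin' (P : Submonoid G) (D : G) : Prop := ∀ k : ℕ, {a : G | a ∈ P ∧ LeftDvd P a (D ^ (k : ℤ))}.Finite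

/-- Right coprimality. -/
def Rcop (P : Submonoid G) (D y : G) (p r : ℤ) : Prop :=
  ∀ s, RightDvd P s (D ^ (-p) * y) → RightDvd P s (D ^ (p + r) * y⁻¹) → RightDvd P s D →
    RightDvd P s 1

theorem cinv_op {P : Submonoid G} {D : G} (hc : CInv P D) : CInv P.op (MulOpposite.op D) := by
  intro e a ha
  have := hc (-e) a.unop ha
  rw [Submonoid.mem_op]
  refine mem_eq this ?_
  simp [mul_assoc]

theorem leftDvd_op {P : Submonoid G} {a b : G} :
    LeftDvd P.op (MulOpposite.op a) (MulOpposite.op b) ↔ RightDvd P a b := by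
  unfold LeftDvd RightDvd
  rw [Submonoid.mem_op]; simp

theorem Rcop_op {P : Submonoid G} {D y : G} {p r : ℤ} :
    Lcop P.op (MulOpposite.op D) (MulOpposite.op y) p r ↔ Rcop P D y p r := by
  constructor
  · intro h s h1 h2 h3
    have := h (MulOpposite.op s) (by simpa [← leftDvd_op] using h1)
      (by simpa [← leftDvd_op] using h2) (leftDvd_op.2 h3)
    exact leftDvd_op.1 this
  · intro h s h1 h2 h3
    have := h (s.unop) (by simpa [← leftDvd_op] using h1)
      (by simpa [← leftDvd_op] using h2) (leftDvd_op.1 h3)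
    exact leftDvd_op.2 this

section
variable (𝒢 : GarsideGroup G)

/-- The right initial factor relative to a fixed exponent `p`. -/
def io (p : ℤ) (z : G) : G := 𝒢.gcdR (𝒢.Δ ^ (-p) * z) 𝒢.Δ

/-- Right cycling relative to `p`. -/
def cy (p : ℤ) (z : G) : G := io 𝒢 p z * z * (io 𝒢 p z)⁻¹

/-- The accumulated conjugating element. -/
def PN (p : ℤ) : ℕ → G → G
  | 0, _ => 1
  | N + 1, z => PN p N (cy 𝒢 p z) * io 𝒢 p z

variable {𝒢}

theorem rtrans {P : Submonoid G} {a b c : G} (h : RightDvd P a b) (h' : RightDvd P b c) : RightDvd P a c := by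
  unfold RightDvd at *; exact mem_eq (mul_mem h' h) (by group)

theorem le_io {p : ℤ} {z u : G} : RightDvd 𝒢.pos u (io 𝒢 p z) ↔
    RightDvd 𝒢.pos u (𝒢.Δ ^ (-p) * z) ∧ RightDvd 𝒢.pos u 𝒢.Δ :=
  ⟨fun h => ⟨rtrans h (𝒢.gcdR_dvd_left _ _), rtrans h (𝒢.gcdR_dvd_right _ _)⟩,
    fun h => 𝒢.dvd_gcdR _ _ _ h.1 h.2⟩

theorem PN_conj (p : ℤ) (N : ℕ) : ∀ z, (cy 𝒢 p)^[N] z = PN 𝒢 p N z * z * (PN 𝒢 p N z)⁻¹ := by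
  induction N with
  | zero => intro z; simp [PN]
  | succ N ih =>
    intro z
    rw [Function.iterate_succ_apply, ih, PN]
    conv_lhs => rw [cy]
    simp only [cy]
    group

theorem rdvd_shift (hc : CInv 𝒢.pos 𝒢.Δ) (e : ℤ) {a b : G} :
    RightDvd 𝒢.pos (𝒢.Δ ^ (-e) * a) b ↔ RightDvd 𝒢.pos a (𝒢.Δ ^ e * b) := by
  unfold RightDvd
  constructor
  · intro h; exact mem_eq (hc e _ h) (by group)
  · intro h; exact mem_eq (hc (-e) _ h) (by group)

theorem rdvd_move {P : Submonoid G} {a b g : G} :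
    RightDvd P (a * g⁻¹) b ↔ RightDvd P a (b * g) := by
  unfold RightDvd
  constructor
  · intro h; exact mem_eq h (by group)
  · intro h; exact mem_eq h (by group)

theorem PN_iff (hc : CInv 𝒢.pos 𝒢.Δ) (p : ℤ) (N : ℕ) : ∀ z u, RightDvd 𝒢.pos u (PN 𝒢 p N z) ↔
    ∀ j : ℕ, j ≤ N → RightDvd 𝒢.pos u (𝒢.Δ ^ ((N : ℤ) - j - p * j) * z ^ (j : ℤ)) := by
  induction N with
  | zero =>
    intro z u
    constructor
    · intro h j hj
      obtain rfl : j = 0 := by omega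
      simpa [PN] using h
    · intro h
      simpa [PN] using h 0 le_rfl
  | succ N ih =>
    intro z u
    have step : ∀ j : ℕ, RightDvd 𝒢.pos (u * (io 𝒢 p z)⁻¹)
        (𝒢.Δ ^ ((N : ℤ) - j - p * j) * (cy 𝒢 p z) ^ (j : ℤ)) ↔
        (RightDvd 𝒢.pos u (𝒢.Δ ^ (((N + 1 : ℕ) : ℤ) - (j + 1 : ℕ) - p * (j + 1 : ℕ)) * z ^ ((j + 1 : ℕ) : ℤ)) ∧
         RightDvd 𝒢.pos u (𝒢.Δ ^ (((N + 1 : ℕ) : ℤ) - j - p * j) * z ^ (j : ℤ))) := by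
      intro j
      have e1 : (cy 𝒢 p z) ^ (j : ℤ) * io 𝒢 p z = io 𝒢 p z * z ^ (j : ℤ) := by
        rw [cy, conj_zpow]; group
      rw [rdvd_move, mul_assoc, e1]
      have e2 : 𝒢.Δ ^ ((N : ℤ) - j - p * j) * (io 𝒢 p z * z ^ (j : ℤ)) =
        (𝒢.Δ ^ ((N : ℤ) - j - p * j) * io 𝒢 p z) * z ^ (j : ℤ) := by group
      rw [e2, ← rdvd_move, ← rdvd_shift hc, le_io, rdvd_shift hc, rdvd_shift hc, rdvd_move, rdvd_move]
      refine and_congr (Eq.to_iff ?_) (Eq.to_iff ?_)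
      · congr 1; push_cast; group
      · congr 1; push_cast; group
    rw [PN, ← rdvd_move, ih]
    constructor
    · intro h j hj
      rcases Nat.lt_or_ge j (N + 1) with hj' | hj'
      · exact ((step j).1 (h j (by omega))).2
      · obtain ⟨i, rfl⟩ : ∃ i, j = i + 1 := ⟨j - 1, by omega⟩
        exact ((step i).1 (h i (by omega))).1
    · intro h j hj
      exact (step j).2 ⟨h (j + 1) (by omega), h j (by omega)⟩

theorem bd_step (hc : CInv 𝒢.pos 𝒢.Δ) {p r : ℤ} (hr : 1 ≤ r) {z : G}
    (h1 : 𝒢.Δ ^ (-p) * z ∈ 𝒢.pos) (h2 : z⁻¹ * 𝒢.Δ ^ (p + r) ∈ 𝒢.pos) :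
    𝒢.Δ ^ (-p) * cy 𝒢 p z ∈ 𝒢.pos ∧ (cy 𝒢 p z)⁻¹ * 𝒢.Δ ^ (p + r) ∈ 𝒢.pos := by
  have hD := 𝒢.Δ_pos
  have hi : RightDvd 𝒢.pos 1 (io 𝒢 p z) := le_io.2 ⟨by unfold RightDvd; simpa using h1, by unfold RightDvd; simpa using hD⟩
  have hw := 𝒢.gcdR_dvd_left (𝒢.Δ ^ (-p) * z) 𝒢.Δ
  have hid := 𝒢.gcdR_dvd_right (𝒢.Δ ^ (-p) * z) 𝒢.Δ
  have hcl : RightDvd 𝒢.pos (𝒢.Δ ^ (-(r - 1)) * (𝒢.Δ ^ (-p) * z)) (io 𝒢 p z) := by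
    rw [le_io]
    constructor
    · unfold RightDvd
      exact mem_eq (hc (-p) _ (hc p _ (zpow_mem_of hD (show 0 ≤ r - 1 by omega)))) (by group)
    · unfold RightDvd
      exact mem_eq (hc 1 _ h2) (by group)
  change RightDvd 𝒢.pos (io 𝒢 p z) _ at hw
  change RightDvd 𝒢.pos (io 𝒢 p z) _ at hid
  unfold RightDvd at *
  unfold cy
  constructor
  · have := mul_mem (hc (-p) _ hi) hw
    exact mem_eq this (by group)
  · have a1 := hc (-(r - 1)) _ hcl
    have a2 := hc (-1 - (p + r - 1)) _ hid
    have a3 := hc (r - 1) _ hcl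
    refine mem_eq (mul_mem hcl a2) ?_
    group

theorem bd_iter (hc : CInv 𝒢.pos 𝒢.Δ) {p r : ℤ} (hr : 1 ≤ r) {z : G}
    (h1 : 𝒢.Δ ^ (-p) * z ∈ 𝒢.pos) (h2 : z⁻¹ * 𝒢.Δ ^ (p + r) ∈ 𝒢.pos) (n : ℕ) :
    𝒢.Δ ^ (-p) * (cy 𝒢 p)^[n] z ∈ 𝒢.pos ∧ ((cy 𝒢 p)^[n] z)⁻¹ * 𝒢.Δ ^ (p + r) ∈ 𝒢.pos := by
  induction n with
  | zero => exact ⟨h1, h2⟩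
  | succ n ih =>
    rw [Function.iterate_succ_apply']
    exact bd_step hc hr ih.1 ih.2

theorem RAposs (hc : CInv 𝒢.pos 𝒢.Δ) {p : ℤ} {y : G} (h1 : 𝒢.Δ ^ (-p) * y ∈ 𝒢.pos) (i : ℕ) :
    𝒢.Δ ^ (-p * i) * y ^ (i : ℤ) ∈ 𝒢.pos := by
  induction i with
  | zero => simp
  | succ i ih =>
    refine mem_eq (mul_mem (hc (-p) _ ih) h1) ?_
    push_cast; group

theorem RApos_s (hc : CInv 𝒢.pos 𝒢.Δ) {p : ℤ} {y s : G} (h1 : 𝒢.Δ ^ (-p) * y ∈ 𝒢.pos)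
    (hs : RightDvd 𝒢.pos s (𝒢.Δ ^ (-p) * y)) (i : ℕ) :
    𝒢.Δ ^ (-p * (i + 1 : ℕ)) * y ^ ((i + 1 : ℕ) : ℤ) * s⁻¹ ∈ 𝒢.pos := by
  unfold RightDvd at hs
  refine mem_eq (mul_mem (hc (-p) _ (RAposs hc h1 i)) hs) ?_
  push_cast; group

theorem asm (D : G) (a b : ℤ) (w s : G) : D ^ a * (D ^ b * w * s) = D ^ (a + b) * w * s := by
  rw [zpow_add]; simp only [mul_assoc]

theorem PN_lower (hc : CInv 𝒢.pos 𝒢.Δ) (hcen : Cen 𝒢.Δ) {p : ℤ} {r : ℕ} (hr : 2 ≤ r) {y : G}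
    (h1 : 𝒢.Δ ^ (-p) * y ∈ 𝒢.pos) (h2 : 𝒢.Δ ^ (p + r) * y⁻¹ ∈ 𝒢.pos) (L : ℕ) (hL : 1 ≤ L) (s : G)
    (s1 : RightDvd 𝒢.pos s (𝒢.Δ ^ (-p) * y)) (s2 : RightDvd 𝒢.pos s (𝒢.Δ ^ (p + r) * y⁻¹))
    (s3 : RightDvd 𝒢.pos s 𝒢.Δ) :
    RightDvd 𝒢.pos (s * (𝒢.Δ ^ (2 * -(p * L)) * y ^ (2 * L : ℤ))) (PN 𝒢 p (2 * r * L) y) := by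
  have hD := 𝒢.Δ_pos
  rw [PN_iff hc]
  intro j hj
  unfold RightDvd
  have e : 𝒢.Δ ^ (((2 * r * L : ℕ) : ℤ) - j - p * j) * y ^ (j : ℤ) * (s * (𝒢.Δ ^ (2 * -(p * L)) * y ^ (2 * L : ℤ)))⁻¹
      = 𝒢.Δ ^ (((2 * r * L : ℕ) : ℤ) - j - p * j + 2 * (p * L)) * y ^ ((j : ℤ) - 2 * L) * s⁻¹ := by
    have := hcen (p * L) (y ^ ((j : ℤ) - 2 * L))
    rw [zpow_add 𝒢.Δ, mul_assoc (𝒢.Δ ^ _) (𝒢.Δ ^ _), this]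
    group
  rw [e]
  rcases lt_trichotomy j (2 * L) with hlt | heq | hgt
  · obtain ⟨i, hi⟩ : ∃ i, 2 * L = j + (i + 1) := ⟨2 * L - j - 1, by omega⟩
    have hi' : (2 * L : ℤ) = j + (i + 1) := by exact_mod_cast hi
    have h2' : 𝒢.Δ ^ (-(-(p + r))) * y⁻¹ ∈ 𝒢.pos := by rw [neg_neg]; exact h2
    have s2' : RightDvd 𝒢.pos s (𝒢.Δ ^ (-(-(p + r))) * y⁻¹) := by rw [neg_neg]; exact s2
    have := RApos_s hc h2' s2' i
    have h0 : (0 : ℤ) ≤ j * (r - 1) := by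
      apply mul_nonneg (Int.natCast_nonneg _); omega
    refine mem_eq (mul_mem (zpow_mem_of hD h0) this) ?_
    rw [asm]
    congr 2
    · congr 1
      push_cast
      linear_combination (r + p) * hi'
    · rw [inv_zpow, ← zpow_neg]; congr 1; push_cast; linarith
  · subst heq
    have h0 : (0 : ℤ) ≤ 2 * L * (r - 1) - 1 := by
      have : (1 : ℤ) ≤ L * (r - 1) := by
        have a : (1 : ℤ) ≤ L := by exact_mod_cast hL
        have b : (1 : ℤ) ≤ r - 1 := by omega
        nlinarith
      nlinarith
    unfold RightDvd at s3
    refine mem_eq (mul_mem (zpow_mem_of hD h0) s3) ?_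
    push_cast
    group
  · obtain ⟨i, hi⟩ : ∃ i, j = 2 * L + (i + 1) := ⟨j - 2 * L - 1, by omega⟩
    have hi' : (j : ℤ) = 2 * L + (i + 1) := by exact_mod_cast hi
    have := RApos_s hc h1 s1 i
    have h0 : (0 : ℤ) ≤ ((2 * r * L : ℕ) : ℤ) - j := by omega
    refine mem_eq (mul_mem (zpow_mem_of hD h0) this) ?_
    rw [asm]
    congr 2
    · congr 1
      push_cast
      linear_combination (-p) * hi'
    · congr 1; push_cast; linarith

theorem rdvd_one {P : Submonoid G} {a : G} : RightDvd P 1 a ↔ a ∈ P := by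
  unfold RightDvd; simp

theorem sup_r (hc : CInv 𝒢.pos 𝒢.Δ) {q : ℤ} {y : G} (h : y⁻¹ * 𝒢.Δ ^ q ∈ 𝒢.pos) :
    𝒢.Δ ^ q * y⁻¹ ∈ 𝒢.pos := mem_eq (hc q _ h) (by group)

/-- If a periodic point is conjugate to `x` in a controlled way, then it is right coprime. -/
theorem core (hc : CInv 𝒢.pos 𝒢.Δ) (hcen : Cen 𝒢.Δ) (hfin : Fin' 𝒢.pos 𝒢.Δ)
    {p : ℤ} {r : ℕ} (hr : 2 ≤ r) {x y v : G}
    (hX : x * 𝒢.Δ ^ (-p) ∈ 𝒢.pos) (hY : x⁻¹ * 𝒢.Δ ^ (p + r) ∈ 𝒢.pos)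
    (hcop : Lcop 𝒢.pos 𝒢.Δ x p r) (hv : v ∈ 𝒢.pos) (M : ℕ) (hv2 : 𝒢.Δ ^ (2 * M : ℤ) * v⁻¹ ∈ 𝒢.pos)
    (hxy : y = v * x * v⁻¹)
    (h1 : 𝒢.Δ ^ (-p) * y ∈ 𝒢.pos) (h2 : y⁻¹ * 𝒢.Δ ^ (p + r) ∈ 𝒢.pos) (L : ℕ) (hL : 1 ≤ L)
    (hper : (cy 𝒢 p)^[2 * r * L] y = y) : Rcop 𝒢.pos 𝒢.Δ y p r := by
  have hD := 𝒢.Δ_pos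
  have h2r := sup_r hc h2
  set c := PN 𝒢 p (2 * r * L) y with hcdef
  have hcy : Commute c y := by
    rw [PN_conj, ← hcdef] at hper
    exact mul_inv_eq_iff_eq_mul.1 hper
  have hcenC : ∀ (k : ℤ) (g : G), Commute (𝒢.Δ ^ (2 * k)) g := fun k g => hcen k g
  set d := c * (𝒢.Δ ^ (2 * -(p * L)) * y ^ (2 * L : ℤ))⁻¹ with hd
  have hdy : Commute d y := by
    apply hcy.mul_left
    apply Commute.inv_left
    exact (hcenC _ _).mul_left ((Commute.refl y).zpow_left _)
  have hlow := PN_lower hc hcen hr h1 h2r L hL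
  have hdP : d ∈ 𝒢.pos := by
    have := hlow 1 (rdvd_one.2 h1) (rdvd_one.2 h2r) (rdvd_one.2 hD)
    rw [one_mul] at this
    exact this
  have hup := (PN_iff hc p (2 * r * L) y c).1 (by rw [← hcdef]; unfold RightDvd; simp)
  -- the two upper bounds, as powers
  have hcd : c⁻¹ = y ^ (-(2 * L) : ℤ) * 𝒢.Δ ^ (2 * (p * L)) * d⁻¹ := by
    rw [hd]; group
  have hE : ∀ i : ℕ, 𝒢.Δ ^ (2 * ((p + r) * (L * i))) * y ^ (-((2 * L * i : ℕ) : ℤ)) * d ^ (-(i : ℤ)) ∈ 𝒢.pos := by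
    intro i
    have h := hup 0 (Nat.zero_le _)
    unfold RightDvd at h
    rw [hcd] at h
    have e : 𝒢.Δ ^ (((2 * r * L : ℕ) : ℤ) - (0 : ℕ) - p * (0 : ℕ)) * y ^ ((0 : ℕ) : ℤ) *
       (y ^ (-(2 * L) : ℤ) * 𝒢.Δ ^ (2 * (p * L)) * d⁻¹) =
       (𝒢.Δ ^ (2 * ((p + r) * L)) * y ^ (-(2 * L) : ℤ)) * d⁻¹ := by
      rw [← hcen (p * L)]
      push_cast; group
    rw [e] at h
    have h' := pow_mem h i
    rw [Commute.mul_pow, Commute.mul_pow] at h'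
    · refine mem_eq h' ?_
      rw [← zpow_natCast, ← zpow_natCast, ← zpow_natCast, ← zpow_mul, ← zpow_mul, inv_zpow, ← zpow_neg]
      congr 3
      · ring
      · push_cast; ring
    · exact hcenC _ _
    · exact (hcenC _ _).mul_left (((hdy.symm).zpow_left _).inv_right)
        |>.trans rfl
  have hF : ∀ i : ℕ, 𝒢.Δ ^ (2 * (-p * ((r - 1) * L * i))) * y ^ ((2 * ((r - 1) * L) * i : ℕ) : ℤ) * d ^ (-(i : ℤ)) ∈ 𝒢.pos := by
    intro i
    have h := hup (2 * r * L) le_rfl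
    unfold RightDvd at h
    rw [hcd] at h
    have hr1 : ((r - 1 : ℕ) : ℤ) = r - 1 := by omega
    have e : 𝒢.Δ ^ (((2 * r * L : ℕ) : ℤ) - (2 * r * L : ℕ) - p * (2 * r * L : ℕ)) * y ^ ((2 * r * L : ℕ) : ℤ) *
       (y ^ (-(2 * L) : ℤ) * 𝒢.Δ ^ (2 * (p * L)) * d⁻¹) =
       (𝒢.Δ ^ (2 * (-p * ((r - 1) * L))) * y ^ (2 * ((r - 1) * L) : ℤ)) * d⁻¹ := by
      rw [← hcen (p * L), ← mul_assoc, ← mul_assoc, mul_assoc (𝒢.Δ ^ _) (y ^ _), ← hcen (p * L)]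
      push_cast; group
    rw [e] at h
    have h' := pow_mem h i
    rw [Commute.mul_pow, Commute.mul_pow] at h'
    · refine mem_eq h' ?_
      rw [← zpow_natCast, ← zpow_natCast, ← zpow_natCast, ← zpow_mul, ← zpow_mul, inv_zpow, ← zpow_neg]
      congr 3
      · ring
      · push_cast; rw [hr1]
    · exact hcenC _ _
    · exact (hcenC _ _).mul_left (((hdy.symm).zpow_left _).inv_right)
        |>.trans rfl
  -- transfer to x
  set d' := v⁻¹ * d * v with hd'
  have hyx : ∀ m : ℤ, v⁻¹ * y ^ m * v = x ^ m := by
    intro m; rw [hxy, conj_zpow]; group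
  have hdd : ∀ m : ℤ, v⁻¹ * d ^ m * v = d' ^ m := by
    intro m
    have := conj_zpow (a := v⁻¹) (b := d) (i := m)
    rw [inv_inv] at this
    rw [hd', this]
  have htr : ∀ (a : ℤ) (m n : ℤ), 𝒢.Δ ^ (2 * a) * y ^ m * d ^ n ∈ 𝒢.pos →
      𝒢.Δ ^ (2 * M : ℤ) * (𝒢.Δ ^ (2 * a) * x ^ m * d' ^ n) ∈ 𝒢.pos := by
    intro a m n h
    refine mem_eq (mul_mem (mul_mem hv2 h) hv) ?_
    rw [← hyx, ← hdd]
    simp only [mul_assoc]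
    rw [← mul_assoc v⁻¹ (𝒢.Δ ^ _), ← hcen a v⁻¹]
    simp only [mul_assoc, mul_inv_cancel_left]
  have hd'x : ∀ m n : ℤ, x ^ m * d' ^ n = d' ^ n * x ^ m := by
    intro m n
    rw [← hyx, ← hdd]
    have : Commute (y ^ m) (d ^ n) := (hdy.symm.zpow_left m).zpow_right n
    have h3 := this.eq
    simp only [mul_assoc, mul_inv_cancel_left]
    rw [← mul_assoc (y ^ m), h3, mul_assoc]
  have hsub : ∀ a m n : ℤ, d' ^ n * (x ^ m * 𝒢.Δ ^ (2 * a) * 𝒢.Δ ^ (2 * M : ℤ)) =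
      𝒢.Δ ^ (2 * M : ℤ) * (𝒢.Δ ^ (2 * a) * x ^ m * d' ^ n) := by
    intro a m n
    rw [mul_assoc (𝒢.Δ ^ (2 * a)) (x ^ m), hd'x, hcen a (d' ^ n * x ^ m), hcen M]
    simp only [mul_assoc]
  have hfinal : ∀ i : ℕ, LeftDvd 𝒢.pos (d' ^ (i : ℤ)) (𝒢.Δ ^ (2 * M : ℤ)) := by
    intro i
    refine descent hD hc (r := r) (by omega) hX hY hcop (2 * ((r - 1) * L) * i) (2 * L * i) _ _ ?_ ?_
    · unfold LeftDvd
      refine mem_eq (htr _ _ _ (hF i)) ?_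
      have hr1 : ((r - 1 : ℕ) : ℤ) = r - 1 := by omega
      have e1 : 𝒢.Δ ^ (-p * ((2 * ((r - 1) * L) * i : ℕ) : ℤ)) = 𝒢.Δ ^ (2 * (-p * ((r - 1) * L * i))) := by
        congr 1; push_cast; rw [hr1]; ring
      rw [e1, ← zpow_neg]
      exact hsub _ _ _
    · unfold LeftDvd
      refine mem_eq (htr _ _ _ (hE i)) ?_
      have e1 : 𝒢.Δ ^ ((p + r) * ((2 * L * i : ℕ) : ℤ)) = 𝒢.Δ ^ (2 * ((p + r) * (L * i))) := by
        congr 1; push_cast; ring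
      rw [e1, ← zpow_neg]
      exact hsub _ _ _
  have hposi : ∀ i : ℕ, 𝒢.Δ ^ (2 * M : ℤ) * d' ^ (i : ℤ) ∈ 𝒢.pos := by
    intro i
    have := htr 0 0 i (by simpa using pow_mem hdP i)
    simpa using this
  have hmem : ∀ i : ℕ, 𝒢.Δ ^ (2 * M : ℤ) * d' ^ (i : ℤ) ∈
      {a : G | a ∈ 𝒢.pos ∧ LeftDvd 𝒢.pos a (𝒢.Δ ^ ((4 * M : ℕ) : ℤ))} := by
    intro i
    refine ⟨hposi i, ?_⟩
    have h := hfinal i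
    unfold LeftDvd at *
    refine mem_eq h ?_
    push_cast
    group
  obtain ⟨i, j, hij, heq⟩ := Set.Finite.exists_lt_map_eq_of_forall_mem hmem (hfin _)
  have hd1 : d = 1 := by
    have e1 : d' ^ (i : ℤ) = d' ^ (j : ℤ) := mul_left_cancel heq
    rw [← hdd, ← hdd] at e1
    have e2 : d ^ (i : ℤ) = d ^ (j : ℤ) := mul_left_cancel (mul_right_cancel e1)
    obtain ⟨m, rfl⟩ : ∃ m, j = i + (m + 1) := ⟨j - i - 1, by omega⟩
    rw [zpow_natCast, zpow_natCast, pow_add] at e2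
    have e3 : d ^ (m + 1) = 1 := by
      have := e2.symm
      rwa [mul_eq_left] at this
    apply 𝒢.pos_antisymm d hdP
    rw [pow_succ] at e3
    rw [← eq_inv_of_mul_eq_one_left e3]
    exact pow_mem hdP m
  intro s s1 s2 s3
  have h := hlow s s1 s2 s3
  have hc1 : c = 𝒢.Δ ^ (2 * -(p * L)) * y ^ (2 * L : ℤ) := by
    rw [hd1] at hd
    exact (mul_inv_eq_one.1 hd.symm)
  rw [← hcdef, hc1] at h
  unfold RightDvd at *
  refine mem_eq h ?_
  group

theorem per_of_Rcop (hc : CInv 𝒢.pos 𝒢.Δ) (hcen : Cen 𝒢.Δ)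
    {p : ℤ} {r : ℕ} (hr : 2 ≤ r) {y : G}
    (h1 : 𝒢.Δ ^ (-p) * y ∈ 𝒢.pos) (h2 : y⁻¹ * 𝒢.Δ ^ (p + r) ∈ 𝒢.pos)
    (hcop : Rcop 𝒢.pos 𝒢.Δ y p r) : (cy 𝒢 p)^[2 * r] y = y := by
  have hD := 𝒢.Δ_pos
  have h2r := sup_r hc h2
  have hlow := PN_lower hc hcen hr h1 h2r 1 le_rfl 1 (rdvd_one.2 h1) (rdvd_one.2 h2r) (rdvd_one.2 hD)
  rw [mul_one, one_mul] at hlow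
  set c := PN 𝒢 p (2 * r) y with hcdef
  have hup := (PN_iff hc p (2 * r) y c).1 (by rw [← hcdef]; unfold RightDvd; simp)
  have u1 := hup 0 (Nat.zero_le _)
  have u2 := hup (2 * r) le_rfl
  have key : RightDvd 𝒢.pos c (𝒢.Δ ^ (2 * -(p * (1 : ℕ))) * y ^ (2 * (1 : ℕ) : ℤ)) := by
    rw [← rdvd_move]
    have := descent (P := 𝒢.pos.op) (D := MulOpposite.op 𝒢.Δ) (x := MulOpposite.op y) (p := p) (r := r) hD (cinv_op hc) (by omega)
      (by rw [Submonoid.mem_op]; simpa using h1) (by rw [Submonoid.mem_op]; simpa using h2r)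
      (Rcop_op.2 hcop) (2 * r - 2) 2 (MulOpposite.op (𝒢.Δ ^ (2 * p) * c * y ^ (-2 : ℤ))) 0
      (by
        have e : (MulOpposite.op y ^ ((2 * r - 2 : ℕ) : ℤ) * MulOpposite.op 𝒢.Δ ^ (-p * ((2 * r - 2 : ℕ) : ℤ)) * MulOpposite.op 𝒢.Δ ^ (0 : ℤ))
          = MulOpposite.op (𝒢.Δ ^ (-p * ((2 * r - 2 : ℕ) : ℤ)) * y ^ ((2 * r - 2 : ℕ) : ℤ)) := by simp
        rw [e, leftDvd_op]
        unfold RightDvd at *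
        have hr1 : ((2 * r - 2 : ℕ) : ℤ) = 2 * r - 2 := by omega
        rw [hr1]
        have := hc (2 * p) _ u2
        refine mem_eq u2 ?_
        have e3 : (𝒢.Δ ^ (2 * p) * c * y ^ (-2 : ℤ))⁻¹ = 𝒢.Δ ^ (2 * -p) * (y ^ (2 : ℤ) * c⁻¹) := by
          rw [hcen (-p) (y ^ (2 : ℤ) * c⁻¹)]; group
        rw [e3, ← mul_assoc, mul_assoc (𝒢.Δ ^ _) (y ^ _), ← hcen]
        push_cast
        group)
      (by
        have e : (MulOpposite.op y ^ (-(2 : ℕ) : ℤ) * MulOpposite.op 𝒢.Δ ^ ((p + r) * ((2 : ℕ) : ℤ)) * MulOpposite.op 𝒢.Δ ^ (0 : ℤ))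
          = MulOpposite.op (𝒢.Δ ^ ((p + r) * ((2 : ℕ) : ℤ)) * y ^ (-(2 : ℕ) : ℤ)) := by simp
        rw [e, leftDvd_op]
        unfold RightDvd at *
        refine mem_eq u1 ?_
        have e3 : (𝒢.Δ ^ (2 * p) * c * y ^ (-2 : ℤ))⁻¹ = 𝒢.Δ ^ (2 * -p) * (y ^ (2 : ℤ) * c⁻¹) := by
          rw [hcen (-p) (y ^ (2 : ℤ) * c⁻¹)]; group
        rw [e3, ← mul_assoc, mul_assoc (𝒢.Δ ^ _) (y ^ _), ← hcen]
        push_cast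
        group)
    have h3 : RightDvd 𝒢.pos (𝒢.Δ ^ (2 * p) * c * y ^ (-2 : ℤ)) 1 := by
      apply leftDvd_op.1; simpa using this
    unfold RightDvd at *
    refine mem_eq h3 ?_
    have e4 := hcen (-p) (y ^ (2 : ℤ) * c⁻¹)
    have e6 : 1 * (𝒢.Δ ^ (2 * p) * c * y ^ (-2 : ℤ))⁻¹ = y ^ (2 : ℤ) * c⁻¹ * 𝒢.Δ ^ (2 * -p) := by group
    rw [e6, ← e4]
    push_cast
    group
  have hceq : c = 𝒢.Δ ^ (2 * -(p * (1 : ℕ))) * y ^ (2 * (1 : ℕ) : ℤ) := by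
    unfold RightDvd at key hlow
    have := 𝒢.pos_antisymm _ hlow (by refine mem_eq key ?_; group)
    exact mul_inv_eq_one.1 this
  rw [PN_conj, ← hcdef, hceq, hcen]
  have e5 := hcen (-(p * (1 : ℕ))) y
  simp only [mul_inv_rev, mul_assoc]
  rw [← mul_assoc (𝒢.Δ ^ _) y, e5]
  group

end
end Ab
end Garside
namespace Garside
namespace Ab

/-! ### Facts about the braid groups -/

section
variable {G : Type*} [Group G]

/-- Abstract braid relations for a sequence of generators. -/
structure BrRel (s : ℕ → G) (N : ℕ) : Prop where
  comm : ∀ i j, i + 1 < j → j < N → s i * s j = s j * s i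
  braid : ∀ i, i + 1 < N → s i * s (i + 1) * s i = s (i + 1) * s i * s (i + 1)

/-- `s_{k-1} ⋯ s_0`. -/
def brA (s : ℕ → G) : ℕ → G
  | 0 => 1
  | k + 1 => s k * brA s k

/-- The half twist on the first `k` generators. -/
def brT (s : ℕ → G) : ℕ → G
  | 0 => 1
  | k + 1 => brT s k * brA s (k + 1)

variable {s : ℕ → G} {N : ℕ}

theorem brA_comm (h : BrRel s N) (k j : ℕ) (hk : k < j) (hj : j < N) :
    s j * brA s k = brA s k * s j := by
  induction k with
  | zero => simp [brA]
  | succ k ih =>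
    rw [brA, ← mul_assoc, ← h.comm k j hk hj, mul_assoc, ih (by omega), mul_assoc]

theorem brT_comm (h : BrRel s N) (k j : ℕ) (hk : k < j) (hj : j < N) :
    s j * brT s k = brT s k * s j := by
  induction k with
  | zero => simp [brT]
  | succ k ih =>
    rw [brT, ← mul_assoc, ih (by omega), mul_assoc, brA_comm h _ _ hk hj, mul_assoc]

theorem brA_shift (h : BrRel s N) (k i : ℕ) (hi : i + 1 < k) (hk : k ≤ N) :
    brA s k * s (i + 1) = s i * brA s k := by
  induction k with
  | zero => omega
  | succ k ih =>
    rcases Nat.lt_or_ge (i + 1) k with h1 | h1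
    · rw [brA, mul_assoc, ih h1 (by omega), ← mul_assoc, ← h.comm i k h1 (by omega), mul_assoc]
    · obtain rfl : k = i + 1 := by omega
      have hb := h.braid i (by omega)
      have hc := brA_comm h i (i + 1) (by omega) (by omega)
      simp only [brA, mul_assoc] at *
      rw [← hc]
      simp only [← mul_assoc] at *
      rw [hb]

theorem brA_two (h : BrRel s N) (k : ℕ) (hk : k < N) :
    brA s k * brA s (k + 1) * s 0 = s k * (brA s k * brA s (k + 1)) := by
  induction k with
  | zero => simp [brA]
  | succ k ih =>
    have hb := h.braid k (by omega)
    have hc := brA_comm h k (k + 1) (by omega) (by omega)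
    have e : brA s (k + 1) * brA s (k + 2) = s k * s (k + 1) * (brA s k * brA s (k + 1)) := by
      rw [brA.eq_2 s (k + 1)]
      conv_lhs => rw [brA]
      rw [mul_assoc, ← mul_assoc (brA s k), ← hc]
      simp only [mul_assoc]
      rfl
    rw [e, mul_assoc, ih (by omega)]
    simp only [← mul_assoc]
    rw [hb]

theorem brT_rev (h : BrRel s N) (k : ℕ) : ∀ i j : ℕ, i + j + 1 = k → k ≤ N →
    brT s k * s i = s j * brT s k := by
  induction k with
  | zero => intro i j hij; omega
  | succ k ih =>
    intro i j hij hk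
    rcases i with _ | i
    · obtain rfl : j = k := by omega
      rcases j with _ | m
      · simp [brT, brA]
      · have := brA_two h (m + 1) (by omega)
        rw [brT, brT, mul_assoc (brT s m), mul_assoc (brT s m), this, ← mul_assoc, ← mul_assoc,
          ← brT_comm h m (m + 1) (by omega) (by omega)]
        simp only [mul_assoc]
    · rw [brT, mul_assoc, brA_shift h (k + 1) i (by omega) hk, ← mul_assoc, ih i j (by omega) (by omega),
        mul_assoc]

end

/-- The generators, extended to all natural numbers. -/
def sB (n : ℕ) (i : ℕ) : BraidGroup n := if h : i < n - 1 then σB n ⟨i, h⟩ else 1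

theorem sB_fin (n : ℕ) (i : Fin (n - 1)) : sB n i = σB n i := by
  unfold sB; rw [dif_pos i.2]

theorem sB_rel (n : ℕ) : BrRel (sB n) (n - 1) := by
  constructor
  · intro i j hij hj
    have hi : i < n - 1 := by omega
    unfold sB
    rw [dif_pos hj, dif_pos hi]
    have : (PresentedGroup.mk (braidRels (n - 1))) (FreeGroup.of ⟨i, hi⟩ * FreeGroup.of ⟨j, hj⟩ * (FreeGroup.of ⟨i, hi⟩)⁻¹ * (FreeGroup.of ⟨j, hj⟩)⁻¹) = 1 := by
      apply PresentedGroup.one_of_mem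
      exact Or.inl ⟨⟨i, hi⟩, ⟨j, hj⟩, hij, rfl⟩
    simp only [map_mul, map_inv] at this
    rw [mul_inv_eq_one, mul_inv_eq_iff_eq_mul] at this
    exact this
  · intro i hj
    have hi : i < n - 1 := by omega
    unfold sB
    rw [dif_pos hj, dif_pos hi]
    have : (PresentedGroup.mk (braidRels (n - 1))) (FreeGroup.of ⟨i, hi⟩ * FreeGroup.of ⟨i + 1, hj⟩ * (FreeGroup.of ⟨i, hi⟩) * (FreeGroup.of ⟨i + 1, hj⟩ * FreeGroup.of ⟨i, hi⟩ * FreeGroup.of ⟨i + 1, hj⟩)⁻¹) = 1 := by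
      apply PresentedGroup.one_of_mem
      exact Or.inr ⟨⟨i, hi⟩, ⟨i + 1, hj⟩, rfl, rfl⟩
    simp only [map_mul, map_inv] at this
    rw [mul_inv_eq_one] at this
    exact this

theorem brA_list {G : Type*} [Group G] (s : ℕ → G) (k : ℕ) :
    ((List.range k).reverse.map s).prod = brA s k := by
  induction k with
  | zero => simp [brA]
  | succ k ih => rw [List.range_succ, brA, ← ih]; simp

theorem brT_list {G : Type*} [Group G] (s : ℕ → G) (k : ℕ) :
    ((List.range k).map fun i => brA s (i + 1)).prod = brT s k := by
  induction k with
  | zero => simp [brT]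
  | succ k ih => rw [List.range_succ, brT, ← ih]; simp

theorem filter_range (k m : ℕ) (hk : k < m) :
    (List.range m).filter (fun j => decide (j ≤ k)) = List.range (k + 1) := by
  induction m with
  | zero => omega
  | succ m ih =>
    rw [List.range_succ, List.filter_append]
    rcases Nat.lt_or_ge k m with h | h
    · rw [ih h]; simp; omega
    · obtain rfl : m = k := by omega
      rw [List.range_succ, List.filter_eq_self.2]
      · simp
      · intro a ha; simp at ha ⊢; omega

theorem halfTwist_eq (n : ℕ) : halfTwist n = brT (sB n) (n - 1) := by
  rw [← brT_list]
  unfold halfTwist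
  rw [← List.map_coe_finRange_eq_range, List.map_map]
  congr 1
  apply List.map_congr_left
  intro k _
  rw [Function.comp, ← brA_list, ← filter_range k (n - 1) k.2, ← List.map_coe_finRange_eq_range, List.filter_map,
    ← List.map_reverse, List.map_map]
  congr 1
  apply List.map_congr_left
  intro j _
  exact (sB_fin n j).symm

theorem ht_rev (n : ℕ) (i : Fin (n - 1)) : ∃ j : Fin (n - 1),
    halfTwist n * σB n i = σB n j * halfTwist n ∧ halfTwist n * σB n j = σB n i * halfTwist n := by
  have hi := i.2
  have hj : n - 1 - 1 - i < n - 1 := by omega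
  refine ⟨⟨n - 1 - 1 - i, hj⟩, ?_, ?_⟩
  · rw [halfTwist_eq, ← sB_fin, ← sB_fin]
    exact brT_rev (sB_rel n) _ _ _ (by simp only; omega) le_rfl
  · rw [halfTwist_eq, ← sB_fin, ← sB_fin]
    exact brT_rev (sB_rel n) _ _ _ (by simp only; omega) le_rfl

theorem braid_cinv (n : ℕ) : CInv (Submonoid.closure (Set.range (σB n))) (halfTwist n) := by
  have h1 : ∀ a ∈ Submonoid.closure (Set.range (σB n)),
      halfTwist n * a * (halfTwist n)⁻¹ ∈ Submonoid.closure (Set.range (σB n)) := by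
    intro a ha
    induction ha using Submonoid.closure_induction with
    | mem x hx =>
      obtain ⟨i, rfl⟩ := hx
      obtain ⟨j, h, _⟩ := ht_rev n i
      rw [h, mul_inv_cancel_right]
      exact Submonoid.subset_closure ⟨j, rfl⟩
    | one => simp
    | mul x y _ _ hx hy => exact mem_eq (mul_mem hx hy) (by group)
  have h2 : ∀ a ∈ Submonoid.closure (Set.range (σB n)),
      (halfTwist n)⁻¹ * a * (halfTwist n) ∈ Submonoid.closure (Set.range (σB n)) := by
    intro a ha
    induction ha using Submonoid.closure_induction with
    | mem x hx =>
      obtain ⟨i, rfl⟩ := hx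
      obtain ⟨j, _, h⟩ := ht_rev n i
      rw [mul_assoc, ← h, inv_mul_cancel_left]
      exact Submonoid.subset_closure ⟨j, rfl⟩
    | one => simp
    | mul x y _ _ hx hy => exact mem_eq (mul_mem hx hy) (by group)
  intro e
  induction e using Int.induction_on with
  | zero => intro a ha; simpa using ha
  | succ k ih => intro a ha; exact mem_eq (ih _ (h1 a ha)) (by group)
  | pred k ih => intro a ha; exact mem_eq (ih _ (h2 a ha)) (by group)

theorem braid_cen (n : ℕ) : Cen (halfTwist n) := by
  have h : ∀ g : BraidGroup n, Commute (halfTwist n ^ (2 : ℤ)) g := by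
    intro g
    have hg : g ∈ Subgroup.closure (Set.range (σB n)) := by
      have : Subgroup.closure (Set.range (σB n)) = ⊤ := PresentedGroup.closure_range_of _
      rw [this]; trivial
    induction hg using Subgroup.closure_induction with
    | mem x hx =>
      obtain ⟨i, rfl⟩ := hx
      obtain ⟨j, h1, h2⟩ := ht_rev n i
      change halfTwist n ^ (2 : ℤ) * σB n i = σB n i * halfTwist n ^ (2 : ℤ)
      rw [zpow_ofNat, pow_two, mul_assoc, h1, ← mul_assoc, h2, mul_assoc]
    | one => exact Commute.one_right _
    | mul x y _ _ hx hy => exact hx.mul_right hy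
    | inv x _ hx => exact hx.inv_right
  intro k g
  rw [zpow_mul]
  exact ((h g).zpow_left k).eq

/-- The exponent sum homomorphism. -/
def brLen (n : ℕ) : BraidGroup n →* Multiplicative ℤ :=
  PresentedGroup.toGroup (f := fun _ => Multiplicative.ofAdd (1 : ℤ)) (by
    rintro r (⟨i, j, _, rfl⟩ | ⟨i, j, _, rfl⟩)
    · simp
    · simp)

theorem brLen_gen (n : ℕ) (i : Fin (n - 1)) : brLen n (σB n i) = Multiplicative.ofAdd (1 : ℤ) := by
  unfold brLen σB
  exact PresentedGroup.toGroup.of _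

theorem word_of_mem {n : ℕ} {a : BraidGroup n} (h : a ∈ Submonoid.closure (Set.range (σB n))) :
    ∃ w : List (Fin (n - 1)), (w.map (σB n)).prod = a ∧ Multiplicative.toAdd (brLen n a) = w.length := by
  induction h using Submonoid.closure_induction with
  | mem x hx =>
    obtain ⟨i, rfl⟩ := hx
    exact ⟨[i], by simp, by rw [brLen_gen]; simp⟩
  | one => exact ⟨[], by simp, by simp⟩
  | mul x y _ _ hx hy =>
    obtain ⟨w, h1, h2⟩ := hx
    obtain ⟨w', h1', h2'⟩ := hy
    exact ⟨w ++ w', by simp [h1, h1'], by rw [map_mul, toAdd_mul, h2, h2']; simp⟩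

theorem braid_fin (n : ℕ) : Fin' (Submonoid.closure (Set.range (σB n))) (halfTwist n) := by
  intro k
  set K := Multiplicative.toAdd (brLen n (halfTwist n ^ (k : ℤ))) with hK
  refine Set.Finite.subset ((List.finite_length_le (Fin (n - 1)) K.toNat).image (fun w => (w.map (σB n)).prod)) ?_
  rintro a ⟨ha, hb⟩
  obtain ⟨w, h1, h2⟩ := word_of_mem ha
  obtain ⟨w', _, h2'⟩ := word_of_mem hb
  refine ⟨w, ?_, h1⟩
  rw [map_mul, map_inv, toAdd_mul, toAdd_inv, h2, ← hK] at h2'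
  simp only [Set.mem_setOf_eq]
  omega

end Ab
end Garside
namespace Garside
namespace Ab

section
variable {G : Type*} [Group G] {P : Submonoid G} {D : G}

/-- Left-weightedness of a pair. -/
abbrev WL (P : Submonoid G) (D : G) (s t : G) : Prop :=
  ∀ u, LeftDvd P u (s * t) → LeftDvd P u D → LeftDvd P u s

/-- Right-weightedness of a pair. -/
abbrev WR (P : Submonoid G) (D : G) (s t : G) : Prop :=
  ∀ u, RightDvd P u (s * t) → RightDvd P u D → RightDvd P u t

theorem prod_le (hc : CInv P D) (l : List G) (hs : ∀ s ∈ l, s ∈ P ∧ LeftDvd P s D) :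
    l.prod ∈ P ∧ l.prod⁻¹ * D ^ (l.length : ℤ) ∈ P := by
  induction l with
  | nil => simp
  | cons a l ih =>
    have h1 := hs a (by simp)
    have h2 := ih (fun s h => hs s (by simp [h]))
    unfold LeftDvd at h1
    constructor
    · rw [List.prod_cons]; exact mul_mem h1.1 h2.1
    · refine mem_eq (mul_mem h2.2 (hc (-(l.length : ℤ)) _ h1.2)) ?_
      rw [List.prod_cons, List.length_cons]; push_cast; group

theorem len_le (hD : D ∈ P) (hc : CInv P D) (hanti : ∀ a : G, a ∈ P → a⁻¹ ∈ P → a = 1) (l : List G)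
    (hs : ∀ s ∈ l, s ∈ P ∧ LeftDvd P s D) (hch : l.IsChain (WL P D)) (h1 : ∀ s ∈ l, s ≠ 1) (k : ℕ)
    (hk : LeftDvd P l.prod (D ^ (k : ℤ))) : l.length ≤ k := by
  by_contra hcon
  rcases List.eq_nil_or_concat' l with rfl | ⟨m, t, rfl⟩
  · simp at hcon
  · have hkm : k ≤ m.length := by simp at hcon; omega
    have := prefix_le hD hc t m hs hch (m ++ [t]).prod (by unfold LeftDvd; simp) (by
      unfold LeftDvd at *
      refine mem_eq (mul_mem hk (zpow_mem_of hD (show (0 : ℤ) ≤ m.length - k by omega))) ?_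
      group)
    unfold LeftDvd at this
    refine h1 t (by simp) (hanti t (hs t (by simp)).1 (mem_eq this ?_))
    simp

theorem op_list {l : List G} (hs : ∀ s ∈ l, s ∈ P ∧ RightDvd P s D) (hch : l.IsChain (WR P D)) :
    (∀ s ∈ (l.map MulOpposite.op).reverse, s ∈ P.op ∧ LeftDvd P.op s (MulOpposite.op D)) ∧
    ((l.map MulOpposite.op).reverse).IsChain (WL P.op (MulOpposite.op D)) ∧
    ((l.map MulOpposite.op).reverse).prod = MulOpposite.op l.prod := by
  refine ⟨?_, ?_, ?_⟩
  · intro s h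
    rw [List.mem_reverse, List.mem_map] at h
    obtain ⟨a, ha, rfl⟩ := h
    exact ⟨(hs a ha).1, leftDvd_op.2 (hs a ha).2⟩
  · rw [List.isChain_reverse, List.isChain_map]
    refine hch.imp ?_
    intro a b hab u h1 h2
    have := hab u.unop (leftDvd_op.1 (by simpa using h1)) (leftDvd_op.1 (by simpa using h2))
    exact leftDvd_op.2 this
  · rw [MulOpposite.op_list_prod]

theorem last_le (hD : D ∈ P) (hc : CInv P D) {l : List G} {b : G}
    (hs : ∀ s ∈ l ++ [b], s ∈ P ∧ RightDvd P s D) (hch : (l ++ [b]).IsChain (WR P D)) (u : G)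
    (h1 : RightDvd P u (l ++ [b]).prod) (h2 : RightDvd P u D) : RightDvd P u b := by
  obtain ⟨a1, a2, a3⟩ := op_list hs hch
  have e : ((l ++ [b]).map MulOpposite.op).reverse = MulOpposite.op b :: (l.map MulOpposite.op).reverse := by simp
  rw [← leftDvd_op, ← a3, e] at h1
  rw [e] at a1 a2
  exact leftDvd_op.1 (head_le (P := P.op) (D := MulOpposite.op D) hD (cinv_op hc) _ _ a1 a2 _ h1 (leftDvd_op.2 h2))

theorem len_leR (hD : D ∈ P) (hc : CInv P D) (hanti : ∀ a : G, a ∈ P → a⁻¹ ∈ P → a = 1) (l : List G)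
    (hs : ∀ s ∈ l, s ∈ P ∧ RightDvd P s D) (hch : l.IsChain (WR P D)) (h1 : ∀ s ∈ l, s ≠ 1) (k : ℕ)
    (hk : RightDvd P l.prod (D ^ (k : ℤ))) : l.length ≤ k := by
  obtain ⟨a1, a2, a3⟩ := op_list hs hch
  have := len_le (P := P.op) (D := MulOpposite.op D) hD (cinv_op hc) (by
    intro a ha hb
    have := hanti a.unop ha hb
    exact MulOpposite.unop_injective this) _ a1 a2 (by
    intro s h
    rw [List.mem_reverse, List.mem_map] at h
    obtain ⟨a, ha, rfl⟩ := h
    intro e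
    exact h1 a ha (MulOpposite.op_injective e)) k (by
      rw [a3, ← MulOpposite.op_zpow]; exact leftDvd_op.2 hk)
  simpa using this

theorem prod_leR (hc : CInv P D) (l : List G) (hs : ∀ s ∈ l, s ∈ P ∧ RightDvd P s D) :
    l.prod ∈ P ∧ D ^ (l.length : ℤ) * l.prod⁻¹ ∈ P := by
  induction l with
  | nil => simp
  | cons a l ih =>
    have h1 := hs a (by simp)
    have h2 := ih (fun s h => hs s (by simp [h]))
    unfold RightDvd at h1
    constructor
    · rw [List.prod_cons]; exact mul_mem h1.1 h2.1
    · refine mem_eq (mul_mem (hc 1 _ h2.2) h1.2) ?_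
      rw [List.prod_cons, List.length_cons]; push_cast; group

end

section
variable {G : Type*} [Group G] {𝒢 : GarsideGroup G}

theorem rantisymm {a b : G} (h1 : RightDvd 𝒢.pos a b) (h2 : RightDvd 𝒢.pos b a) : a = b := by
  unfold RightDvd at *
  have := 𝒢.pos_antisymm _ h1 (mem_eq h2 (by group))
  exact (mul_inv_eq_one.1 this).symm

theorem rnf_data {q : ℤ} {l : List G} {z : G} (h : IsRightNF 𝒢.pos 𝒢.Δ 𝒢.gcdR q l z) :
    (∀ s ∈ l, s ∈ 𝒢.pos ∧ RightDvd 𝒢.pos s 𝒢.Δ) ∧ l.IsChain (WR 𝒢.pos 𝒢.Δ) := by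
  refine ⟨fun s hs => (𝒢.divisors_Δ s).1 (h.2.1 s hs).1, ?_⟩
  refine List.IsChain.imp ?_ h.2.2
  intro s t e u h1 h2
  have := 𝒢.dvd_gcdR _ _ _ h1 h2
  rwa [e] at this

theorem lnf_data {q : ℤ} {l : List G} {z : G} (h : IsLeftNF 𝒢.pos 𝒢.Δ 𝒢.gcdL q l z) :
    (∀ s ∈ l, s ∈ 𝒢.pos ∧ LeftDvd 𝒢.pos s 𝒢.Δ) ∧ l.IsChain (WL 𝒢.pos 𝒢.Δ) := by
  refine ⟨fun s hs => (h.2.1 s hs).1, ?_⟩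
  refine List.IsChain.imp ?_ h.2.2
  intro s t e u h1 h2
  have := 𝒢.dvd_gcdL _ _ _ h1 h2
  rwa [e] at this

theorem rnf_facts (hc : CInv 𝒢.pos 𝒢.Δ) {p : ℤ} {r : ℕ} (hr : 1 ≤ r) {z : G}
    (b1 : 𝒢.Δ ^ (-p) * z ∈ 𝒢.pos) (b2 : z⁻¹ * 𝒢.Δ ^ (p + r) ∈ 𝒢.pos)
    (n1 : 𝒢.Δ ^ (-p - 1) * z ∉ 𝒢.pos) (n2 : 𝒢.Δ ^ (p + r - 1) * z⁻¹ ∉ 𝒢.pos) {q : ℤ} {l : List G}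
    (h : IsRightNF 𝒢.pos 𝒢.Δ 𝒢.gcdR q l z) :
    q = p ∧ l.length = r ∧ ∀ l' b, l = l' ++ [b] → 𝒢.Δ ^ (-p) * b * 𝒢.Δ ^ p = io 𝒢 p z := by
  have hD := 𝒢.Δ_pos
  obtain ⟨hs, hch⟩ := rnf_data h
  obtain ⟨hz, hpr, -⟩ := h
  obtain ⟨hl1, hl2⟩ := prod_leR hc l hs
  have hq1 : q ≤ p := by
    by_contra hcon
    apply n1
    refine mem_eq (mul_mem (hc (-p - 1) _ hl1) (zpow_mem_of hD (show 0 ≤ q - p - 1 by omega))) ?_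
    rw [hz]; group
  have hq2 : p ≤ q := by
    by_contra hcon
    have hw : l.prod * 𝒢.Δ ^ (q - p) ∈ 𝒢.pos := by
      refine mem_eq (hc p _ b1) ?_
      rw [hz]; group
    have hle : RightDvd 𝒢.pos 𝒢.Δ l.prod := by
      unfold RightDvd
      refine mem_eq (mul_mem hw (zpow_mem_of hD (show 0 ≤ p - q - 1 by omega))) ?_
      group
    rcases List.eq_nil_or_concat' l with rfl | ⟨m, t, rfl⟩
    · have : 𝒢.Δ = 1 := by
        apply 𝒢.pos_antisymm _ hD
        unfold RightDvd at hle
        simpa using hle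
      apply n1
      rw [hz, this]; simp
    · have h3 := last_le hD hc hs hch _ hle (by unfold RightDvd; simp)
      exact (hpr t (by simp)).2.2 (rantisymm (hs t (by simp)).2 h3)
  obtain rfl : q = p := le_antisymm hq1 hq2
  refine ⟨rfl, ?_, ?_⟩
  · apply le_antisymm
    · refine len_leR hD hc 𝒢.pos_antisymm l hs hch (fun s h => (hpr s h).2.1) r ?_
      unfold RightDvd
      refine mem_eq (hc (q + r) _ b2) ?_
      rw [hz]; group
    · by_contra hcon
      apply n2
      refine mem_eq (mul_mem (zpow_mem_of hD (show (0 : ℤ) ≤ r - 1 - l.length by omega)) hl2) ?_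
      rw [hz]; group
  · rintro l' b rfl
    have hb := hs b (by simp)
    apply rantisymm (𝒢 := 𝒢)
    · rw [le_io]
      constructor
      · unfold RightDvd
        have : (l'.prod) ∈ 𝒢.pos := (prod_leR hc l' (fun s h => hs s (by simp [h]))).1
        refine mem_eq (hc (-q) _ this) ?_
        rw [hz, List.prod_append, List.prod_singleton]; group
      · unfold RightDvd at *
        refine mem_eq (hc (-q) _ hb.2) ?_
        group
    · have h1 := 𝒢.gcdR_dvd_left (𝒢.Δ ^ (-q) * z) 𝒢.Δ
      have h2 := 𝒢.gcdR_dvd_right (𝒢.Δ ^ (-q) * z) 𝒢.Δ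
      have := last_le hD hc hs hch (𝒢.Δ ^ q * io 𝒢 q z * 𝒢.Δ ^ (-q)) (by
        unfold RightDvd at *
        refine mem_eq (hc q _ h1) ?_
        rw [hz, io]; group) (by
        unfold RightDvd at *
        refine mem_eq (hc q _ h2) ?_
        rw [io]; group)
      unfold RightDvd at *
      refine mem_eq (hc (-q) _ this) ?_
      group

theorem iotaR_eq (hc : CInv 𝒢.pos 𝒢.Δ) {p : ℤ} {r : ℕ} (hr : 1 ≤ r) {z : G}
    (b1 : 𝒢.Δ ^ (-p) * z ∈ 𝒢.pos) (b2 : z⁻¹ * 𝒢.Δ ^ (p + r) ∈ 𝒢.pos)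
    (n1 : 𝒢.Δ ^ (-p - 1) * z ∉ 𝒢.pos) (n2 : 𝒢.Δ ^ (p + r - 1) * z⁻¹ ∉ 𝒢.pos) :
    (𝒢.rnf z).1 = p ∧ (𝒢.rnf z).2.length = r ∧ 𝒢.iotaR z = io 𝒢 p z := by
  obtain ⟨h1, h2, h3⟩ := rnf_facts hc hr b1 b2 n1 n2 (Classical.choose_spec (𝒢.rnf_exists z))
  change (𝒢.rnf z).1 = p at h1
  change (𝒢.rnf z).2.length = r at h2
  refine ⟨h1, h2, ?_⟩
  rcases List.eq_nil_or_concat' (𝒢.rnf z).2 with e | ⟨m, t, e⟩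
  · rw [e] at h2; simp at h2; omega
  · rw [← h3 m t e, GarsideGroup.iotaR, GarsideGroup.tau, h1, e]
    simp

theorem rigid_of_Rcop (hc : CInv 𝒢.pos 𝒢.Δ) {p : ℤ} {r : ℕ} (hr : 1 ≤ r) {y : G}
    (b1 : 𝒢.Δ ^ (-p) * y ∈ 𝒢.pos) (b2 : y⁻¹ * 𝒢.Δ ^ (p + r) ∈ 𝒢.pos)
    (n1 : 𝒢.Δ ^ (-p - 1) * y ∉ 𝒢.pos) (n2 : 𝒢.Δ ^ (p + r - 1) * y⁻¹ ∉ 𝒢.pos)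
    (hcop : Rcop 𝒢.pos 𝒢.Δ y p r) : 𝒢.RightRigid y := by
  have hD := 𝒢.Δ_pos
  have hnf : IsRightNF 𝒢.pos 𝒢.Δ 𝒢.gcdR (𝒢.rnf y).1 (𝒢.rnf y).2 y := Classical.choose_spec (𝒢.rnf_exists y)
  obtain ⟨h1, h2, h3⟩ := iotaR_eq hc hr b1 b2 n1 n2
  obtain ⟨-, -, h4⟩ := rnf_facts hc hr b1 b2 n1 n2 hnf
  unfold GarsideGroup.RightRigid
  generalize (𝒢.rnf y).2 = l at *
  generalize (𝒢.rnf y).1 = q at *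
  subst h1
  rw [h3]
  obtain ⟨hs, hch⟩ := rnf_data hnf
  obtain ⟨hz, hpr, hchain⟩ := hnf
  have hne : l ≠ [] := by rintro rfl; simp at h2; omega
  obtain ⟨m, b, hmb⟩ : ∃ m b, l = m ++ [b] := (List.eq_nil_or_concat' l).resolve_left hne
  have hio := h4 m b hmb
  have hbp := hpr b (by simp [hmb])
  have hioP : io 𝒢 q y ∈ 𝒢.pos := by
    rw [← hio]; exact mem_eq (hc (-q) _ hbp.1.1) (by group)
  have hioD : RightDvd 𝒢.pos (io 𝒢 q y) 𝒢.Δ := 𝒢.gcdR_dvd_right _ _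
  have hioX : RightDvd 𝒢.pos (io 𝒢 q y) (𝒢.Δ ^ (-q) * y) := 𝒢.gcdR_dvd_left _ _
  refine ⟨hne, ?_, ?_, ?_⟩
  · rw [List.prod_cons, mul_assoc, ← hz]
  · intro s hsm
    rcases List.mem_cons.1 hsm with rfl | hsm
    · refine ⟨(𝒢.divisors_Δ _).2 ⟨hioP, hioD⟩, ?_, ?_⟩
      · intro e
        rw [← hio] at e
        apply hbp.2.1
        have : b = 𝒢.Δ ^ q * (𝒢.Δ ^ (-q) * b * 𝒢.Δ ^ q) * 𝒢.Δ ^ (-q) := by group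
        rw [this, e]; group
      · intro e
        rw [← hio] at e
        apply hbp.2.2
        have : b = 𝒢.Δ ^ q * (𝒢.Δ ^ (-q) * b * 𝒢.Δ ^ q) * 𝒢.Δ ^ (-q) := by group
        rw [this, e]; group
    · exact hpr s hsm
  · obtain ⟨a, l', rfl⟩ := List.exists_cons_of_ne_nil hne
    refine List.IsChain.cons_cons ?_ hchain
    have ha := hs a (by simp)
    have hl' := (prod_leR hc l' (fun s h => hs s (by simp [h]))).2
    have hlen : (l'.length : ℤ) = r - 1 := by simp at h2; omega
    rw [hlen] at hl'
    have g1 := 𝒢.gcdR_dvd_left (io 𝒢 q y * a) 𝒢.Δ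
    have g2 := 𝒢.gcdR_dvd_right (io 𝒢 q y * a) 𝒢.Δ
    have g3 := 𝒢.dvd_gcdR (io 𝒢 q y * a) 𝒢.Δ a (by unfold RightDvd; simpa using hioP) ha.2
    generalize 𝒢.gcdR (io 𝒢 q y * a) 𝒢.Δ = g at *
    have s1 : RightDvd 𝒢.pos (g * a⁻¹) (io 𝒢 q y) := by
      unfold RightDvd at *; exact mem_eq g1 (by group)
    have key := hcop (g * a⁻¹) (rtrans s1 hioX) (by
      unfold RightDvd at *
      refine mem_eq (mul_mem (hc 1 _ hl') g2) ?_
      rw [hz, List.prod_cons]; group) (rtrans s1 hioD)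
    unfold RightDvd at key g3
    have := 𝒢.pos_antisymm _ g3 (mem_eq key (by group))
    exact mul_inv_eq_one.1 this

theorem Rcop_of_rigid (hc : CInv 𝒢.pos 𝒢.Δ) {p : ℤ} {r : ℕ} {y : G}
    (h1 : (𝒢.rnf y).1 = p) (h2 : (𝒢.rnf y).2.length = r) (h : 𝒢.RightRigid y) :
    Rcop 𝒢.pos 𝒢.Δ y p r := by
  have hD := 𝒢.Δ_pos
  obtain ⟨hne, hnf⟩ := h
  have hy : y = (𝒢.rnf y).2.prod * 𝒢.Δ ^ (𝒢.rnf y).1 := (Classical.choose_spec (𝒢.rnf_exists y)).1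
  obtain ⟨hs, hch⟩ := rnf_data hnf
  obtain ⟨a1, a2, a3⟩ := op_list hs hch
  have e : ((𝒢.iotaR y :: (𝒢.rnf y).2).map MulOpposite.op).reverse =
    ((𝒢.rnf y).2.map MulOpposite.op).reverse ++ [MulOpposite.op (𝒢.iotaR y)] := by simp
  rw [e] at a1 a2
  have := Lcop_of_chain (P := 𝒢.pos.op) (D := MulOpposite.op 𝒢.Δ) (x := MulOpposite.op y) (p := p)
    hD (cinv_op hc) (by
      rw [← MulOpposite.op_list_prod, ← MulOpposite.op_zpow, ← MulOpposite.op_mul, ← h1, ← hy]) a1 a2 (by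
      intro a m hl
      have hlast : (𝒢.rnf y).2.getLast? = some a.unop := by
        have : (((𝒢.rnf y).2.map MulOpposite.op).reverse).head? = some a := by rw [hl]; rfl
        rw [List.head?_reverse, List.getLast?_map, Option.map_eq_some_iff] at this
        obtain ⟨b, hb, rfl⟩ := this
        exact hb
      rw [GarsideGroup.iotaR, GarsideGroup.tau, hlast, h1]
      simp [mul_assoc]) (by simpa using hne)
  rw [List.length_reverse, List.length_map, h2] at this
  exact Rcop_op.1 this

/-- The main theorem, for an abstract Garside group with the relevant properties. -/
theorem main (hc : CInv 𝒢.pos 𝒢.Δ) (hcen : Cen 𝒢.Δ) (hfin : Fin' 𝒢.pos 𝒢.Δ) (x : G) (r : ℕ)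
    (hr : 𝒢.len x = r) (hr1 : 1 < r) (hx : 𝒢.LeftRigid x) :
    (∃ t : ℕ, 𝒢.RightRigid ((𝒢.cR)^[2 * r * t] x)) ∧
    ∀ t t' : ℕ, 𝒢.RightRigid ((𝒢.cR)^[2 * r * t] x) →
      𝒢.RightRigid ((𝒢.cR)^[2 * r * t'] x) →
      (𝒢.cR)^[2 * r * t] x = (𝒢.cR)^[2 * r * t'] x := by
  have hD := 𝒢.Δ_pos
  have hcen2 : ∀ g, 𝒢.Δ ^ 2 * g = g * 𝒢.Δ ^ 2 := by
    intro g; have := hcen 1 g; simpa [zpow_ofNat] using this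
  have hxnf : IsLeftNF 𝒢.pos 𝒢.Δ 𝒢.gcdL (𝒢.lnf x).1 (𝒢.lnf x).2 x := Classical.choose_spec (𝒢.lnf_exists x)
  obtain ⟨hne, hnf⟩ := hx
  unfold GarsideGroup.len at hr
  have hcop : Lcop 𝒢.pos 𝒢.Δ x (𝒢.lnf x).1 r := by
    rw [← hr]
    refine Lcop_of_chain hD hc hxnf.1 (lnf_data hnf).1 (lnf_data hnf).2 ?_ hne
    intro a m hl
    rw [GarsideGroup.iotaL, GarsideGroup.tau, hl]
    simp
  clear hnf
  generalize (𝒢.lnf x).2 = l at *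
  generalize (𝒢.lnf x).1 = p at *
  obtain ⟨hs, hch⟩ := lnf_data hxnf
  obtain ⟨hxe, hpr, -⟩ := hxnf
  obtain ⟨hl1, hl2⟩ := prod_le hc l hs
  rw [hr] at hl2
  have hX : x * 𝒢.Δ ^ (-p) ∈ 𝒢.pos := by rw [hxe]; exact hc p _ hl1
  have hY : x⁻¹ * 𝒢.Δ ^ (p + r) ∈ 𝒢.pos := by
    refine mem_eq hl2 ?_
    rw [hxe]; group
  have nX : ¬ LeftDvd 𝒢.pos 𝒢.Δ (x * 𝒢.Δ ^ (-p)) := by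
    intro h
    obtain ⟨a, m, rfl⟩ := List.exists_cons_of_ne_nil hne
    have h3 := head_le hD hc m a hs hch 𝒢.Δ (by
      unfold LeftDvd at *
      refine mem_eq (hc (-p) _ h) ?_
      rw [hxe]; group) (by unfold LeftDvd; simp)
    have ha := hs a (by simp)
    apply (hpr a (by simp)).2.2
    unfold LeftDvd at ha h3
    have := 𝒢.pos_antisymm _ ha.2 (mem_eq h3 (by group))
    exact inv_mul_eq_one.1 this
  have nY : ¬ LeftDvd 𝒢.pos 𝒢.Δ (x⁻¹ * 𝒢.Δ ^ (p + r)) := by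
    intro h
    have := len_le hD hc 𝒢.pos_antisymm l hs hch (fun s h => (hpr s h).2.1) (r - 1) (by
      have e : ((r - 1 : ℕ) : ℤ) = r - 1 := by omega
      rw [e]
      unfold LeftDvd at *
      refine mem_eq (hc 1 _ h) ?_
      rw [hxe]; group)
    omega
  have hX' : 𝒢.Δ ^ (-p) * x ∈ 𝒢.pos := mem_eq (hc (-p) _ hX) (by group)
  have hB := fun i => bd_iter (𝒢 := 𝒢) hc (p := p) (r := r) (by omega) hX' hY i
  have hv : ∀ i, PN 𝒢 p i x ∈ 𝒢.pos := by
    intro i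
    rw [← rdvd_one, PN_iff hc]
    intro j hj
    rw [rdvd_one]
    refine mem_eq (mul_mem (zpow_mem_of hD (show (0 : ℤ) ≤ i - j by omega)) (RAposs hc hX' j)) ?_
    rw [← mul_assoc, ← zpow_add]; congr 2; ring
  have hv2 : ∀ i : ℕ, 𝒢.Δ ^ (2 * i : ℤ) * (PN 𝒢 p i x)⁻¹ ∈ 𝒢.pos := by
    intro i
    have := (PN_iff hc p i x (PN 𝒢 p i x)).1 (by unfold RightDvd; simp) 0 (by omega)
    unfold RightDvd at this
    refine mem_eq (mul_mem (zpow_mem_of hD (show (0 : ℤ) ≤ i by omega)) this) ?_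
    push_cast; group
  have hN1 : ∀ i, 𝒢.Δ ^ (-p - 1) * (cy 𝒢 p)^[i] x ∉ 𝒢.pos := by
    intro i h
    rw [PN_conj] at h
    exact nX (exact_inf hD hc hcen2 (by omega) hX hcop _ i (hv i) (hv2 i) h)
  have hN2 : ∀ i, 𝒢.Δ ^ (p + r - 1) * ((cy 𝒢 p)^[i] x)⁻¹ ∉ 𝒢.pos := by
    intro i h
    rw [PN_conj] at h
    have := exact_inf hD hc hcen2 (show (1 : ℤ) ≤ r by omega) (mem_eq hY (by rw [neg_neg])) hcop.inv _ i (hv i) (hv2 i)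
      (mem_eq h (by rw [neg_neg]; group))
    rw [neg_neg] at this
    exact nY this
  have hI := fun i => iotaR_eq (𝒢 := 𝒢) hc (show 1 ≤ r by omega) (hB i).1 (hB i).2 (hN1 i) (hN2 i)
  have hcR : ∀ i, (𝒢.cR)^[i] x = (cy 𝒢 p)^[i] x := by
    intro i
    induction i with
    | zero => rfl
    | succ i ih =>
      rw [Function.iterate_succ_apply', Function.iterate_succ_apply', ih, GarsideGroup.cR, (hI i).2.2, cy]
  simp only [hcR]
  constructor
  · have hmem : ∀ i : ℕ, 𝒢.Δ ^ (-p) * (cy 𝒢 p)^[i] x ∈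
        {a : G | a ∈ 𝒢.pos ∧ LeftDvd 𝒢.pos a (𝒢.Δ ^ (r : ℤ))} := by
      intro i
      refine ⟨(hB i).1, ?_⟩
      unfold LeftDvd
      refine mem_eq (hB i).2 ?_
      group
    obtain ⟨a, b, hab, heq⟩ := Set.Finite.exists_lt_map_eq_of_forall_mem hmem (hfin _)
    have heq' := mul_left_cancel heq
    refine ⟨a, rigid_of_Rcop hc (by omega) (hB _).1 (hB _).2 (hN1 _) (hN2 _) ?_⟩
    refine core hc hcen hfin (by omega) hX hY hcop (hv (2 * r * a)) (2 * r * a) (hv2 _) (PN_conj _ _ _)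
      (hB _).1 (hB _).2 (b - a) (by omega) ?_
    set f := cy 𝒢 p
    have hper : f^[b - a] (f^[a] x) = f^[a] x := by
      rw [← Function.iterate_add_apply, heq']; congr 2; omega
    have hper2 : Function.IsPeriodicPt f (b - a) (f^[a] x) := hper
    have hper3 : Function.IsPeriodicPt f (2 * r * (b - a)) (f^[2 * r * a] x) := by
      obtain ⟨k, hk⟩ : ∃ k, 2 * r * a = k + a := ⟨2 * r * a - a, by
        have : a ≤ 2 * r * a := Nat.le_mul_of_pos_left _ (by omega)
        omega⟩
      rw [hk, Function.iterate_add_apply]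
      exact (hper2.apply_iterate k).const_mul _
    exact hper3
  · have key : ∀ t k : ℕ, 𝒢.RightRigid ((cy 𝒢 p)^[2 * r * t] x) →
        (cy 𝒢 p)^[2 * r * (t + k)] x = (cy 𝒢 p)^[2 * r * t] x := by
      intro t k h
      have hR := Rcop_of_rigid hc (hI _).1 (hI _).2.1 h
      have h3 : Function.IsPeriodicPt (cy 𝒢 p) (2 * r) ((cy 𝒢 p)^[2 * r * t] x) :=
        per_of_Rcop hc hcen (by omega) (hB _).1 (hB _).2 hR
      have h4 := h3.mul_const k
      rw [mul_add, add_comm, Function.iterate_add_apply]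
      exact h4
    intro t t' h h'
    rcases le_total t t' with hle | hle
    · obtain ⟨k, rfl⟩ := Nat.exists_eq_add_of_le hle
      exact (key t k h).symm
    · obtain ⟨k, rfl⟩ := Nat.exists_eq_add_of_le hle
      exact key t' k h'

end
end Ab
end Garside
namespace Garside

/-- **Well-definedness of `Φ`.** Let `x ∈ Bₙ` be a left rigid braid with
`ℓ(x) = r > 1`. Then there is some `t ≥ 0` such that `c_R^{2rt}(x)` is right
rigid, and any two such values of `t` yield the same element; hence
`Φ(x) = c_R^{2rt}(x)` is well defined. -/
theorem Phi_well_defined {n : ℕ} (𝒢 : GarsideGroup (BraidGroup n))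
    (h𝒢 : IsBraidGarside n 𝒢) (x : BraidGroup n) (r : ℕ)
    (hr : 𝒢.len x = r) (hr1 : 1 < r) (hx : 𝒢.LeftRigid x) :
    (∃ t : ℕ, 𝒢.RightRigid ((𝒢.cR)^[2 * r * t] x)) ∧
    ∀ t t' : ℕ, 𝒢.RightRigid ((𝒢.cR)^[2 * r * t] x) →
      𝒢.RightRigid ((𝒢.cR)^[2 * r * t'] x) →
      (𝒢.cR)^[2 * r * t] x = (𝒢.cR)^[2 * r * t'] x := by
  obtain ⟨h1, h2⟩ := h𝒢
  exact Ab.main (by rw [h1, h2]; exact Ab.braid_cinv n) (by rw [h2]; exact Ab.braid_cen n)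
    (by rw [h1, h2]; exact Ab.braid_fin n) x r hr hr1 hx

end Garside
end
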